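/- If α is exponentially closed and OTM-clockable, then α·2 is clockable by an OTM that uses only one tape. -/

import Mathlib

open Ordinal

noncomputable section

/-- liminf at `α` of an ordinal-indexed sequence of ordinals:
the sup over `γ < α` of the inf of the values on `[γ, α)`. -/
noncomputable def liminfAt (α : Ordinal.{0}) (p : Ordinal.{0} → Ordinal.{0}) : Ordinal :=
  ⨆ γ : Set.Iio α, sInf (p '' {i | γ.1 ≤ i ∧ i < α})

/-- liminf at `α` of a `Bool`-valued sequence (with `false < true`):
`true` iff the value is eventually `true` before `α`. -/
noncomputable def boolLiminfAt (α : Ordinal.{0}) (b : Ordinal.{0} → Bool) : Bool :=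
  open scoped Classical in
  if (∃ γ < α, ∀ i, γ ≤ i → i < α → b i = true) then true else false

/-- liminf at `α` of a `ℕ`-valued sequence, with the convention that an
unbounded sequence has liminf `0` (reset/overflow rule). -/
noncomputable def natLiminfAt (α : Ordinal.{0}) (s : Ordinal.{0} → ℕ) : ℕ :=
  (liminfAt α (fun i => (s i : Ordinal))).card.toNat

open scoped Classical in
/-- Moving a head one step to the left: predecessor at successors, `0` at `0` and at limits. -/
noncomputable def leftOf (o : Ordinal.{0}) : Ordinal :=
  if h : ∃ p, o = p + 1 then Classical.choose h else 0

/-- A program for an Ordinal Turing Machine (Koepke), with finitely many tapes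
(of proper-class length) and finitely many states.  `trans` maps the current state
and the symbols read by the heads either to `none` (halt) or to a new state, the
symbols to be written, and for each tape the direction of head movement
(`true` = right, `false` = left). -/
structure OTMProgram where
  tapes : ℕ
  states : ℕ
  trans : Fin (states + 1) → (Fin tapes → Bool) →
    Option (Fin (states + 1) × (Fin tapes → Bool) × (Fin tapes → Bool))

/-- A configuration of an OTM: inner state, head positions and tape contents. -/
structure OTMConfig (P : OTMProgram) where
  state : Fin (P.states + 1)
  head : Fin P.tapes → Ordinal.{0}
  tape : Fin P.tapes → Ordinal.{0} → Bool

namespace OTMProgram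

variable (P : OTMProgram)

/-- The symbols currently read by the heads. -/
def readSymbols (c : OTMConfig P) : Fin P.tapes → Bool :=
  fun t => c.tape t (c.head t)

/-- One computation step; a halted configuration stays unchanged. -/
noncomputable def stepConfig (c : OTMConfig P) : OTMConfig P :=
  match P.trans c.state (P.readSymbols c) with
  | none => c
  | some (s', w, mv) =>
      { state := s'
        head := fun t => if mv t then c.head t + 1 else leftOf (c.head t)
        tape := fun t i => if i = c.head t then w t else c.tape t i }

/-- The configuration at a limit time, determined by the liminf rules for the
state, the head positions and the cell contents. -/
noncomputable def limitConfig (lam : Ordinal.{0}) (g : ∀ β, β < lam → OTMConfig P) :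
    OTMConfig P :=
  { state := ⟨natLiminfAt lam
        (fun i => if h : i < lam then ((g i h).state : ℕ) else 0) % (P.states + 1),
      Nat.mod_lt _ (Nat.succ_pos _)⟩
    head := fun t => liminfAt lam (fun i => if h : i < lam then (g i h).head t else 0)
    tape := fun t j =>
      boolLiminfAt lam (fun i => if h : i < lam then (g i h).tape t j else false) }

/-- The initial configuration: state `0`, all heads on cell `0`, empty tapes. -/
def initConfig : OTMConfig P :=
  { state := ⟨0, Nat.succ_pos _⟩, head := fun _ => 0, tape := fun _ _ => false }

/-- The run of an OTM-program (on empty input, without parameters):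
the configuration at each ordinal time. -/
noncomputable def run (o : Ordinal.{0}) : OTMConfig P :=
  Ordinal.limitRecOn o P.initConfig (fun _ ih => P.stepConfig ih)
    (fun lam _ ih => P.limitConfig lam ih)

/-- The machine is in a halting configuration at time `τ`. -/
def haltedAt (τ : Ordinal.{0}) : Prop :=
  P.trans (P.run τ).state (P.readSymbols (P.run τ)) = none

/-- The machine halts exactly at time `τ`. -/
def haltsAt (τ : Ordinal.{0}) : Prop :=
  P.haltedAt τ ∧ ∀ σ < τ, ¬ P.haltedAt σ

end OTMProgram

/-- An ordinal `α` is OTM-clockable iff some OTM-program halts at time `α + 1`. -/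
def OTMClockable (α : Ordinal.{0}) : Prop :=
  ∃ P : OTMProgram, P.haltsAt (α + 1)

/-- `α` is closed under ordinal exponentiation. -/
def ExpClosed (α : Ordinal.{0}) : Prop :=
  ∀ β < α, ∀ γ < α, β ^ γ < α


open Ordinal Order

theorem lt_liminfAt {lam x : Ordinal.{0}} {p : Ordinal.{0} → Ordinal.{0}} :
    x < liminfAt lam p ↔ ∃ γ < lam, ∀ i, γ ≤ i → i < lam → x < p i := by
  unfold liminfAt
  rw [Ordinal.lt_iSup_iff]
  constructor
  · rintro ⟨⟨γ, hγ⟩, h⟩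
    refine ⟨γ, hγ, fun i h1 h2 => h.trans_le (csInf_le' ⟨i, ⟨h1, h2⟩, rfl⟩)⟩
  · rintro ⟨γ, hγ, h⟩
    refine ⟨⟨γ, hγ⟩, ?_⟩
    have hne : (p '' {i | γ ≤ i ∧ i < lam}).Nonempty := ⟨_, γ, ⟨le_rfl, hγ⟩, rfl⟩
    obtain ⟨i, ⟨h1, h2⟩, h3⟩ := csInf_mem hne
    rw [← h3]
    exact h i h1 h2

theorem liminfAt_congr {lam : Ordinal.{0}} {p q : Ordinal.{0} → Ordinal.{0}}
    (h : ∀ i < lam, p i = q i) : liminfAt lam p = liminfAt lam q := by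
  apply eq_of_forall_lt_iff
  intro c
  simp only [lt_liminfAt]
  constructor <;> rintro ⟨γ, hγ, h1⟩ <;> refine ⟨γ, hγ, fun i h2 h3 => ?_⟩
  · rw [← h i h3]; exact h1 i h2 h3
  · rw [h i h3]; exact h1 i h2 h3

theorem boolLiminfAt_eq_true {lam : Ordinal.{0}} {b : Ordinal.{0} → Bool} :
    boolLiminfAt lam b = true ↔ ∃ γ < lam, ∀ i, γ ≤ i → i < lam → b i = true := by
  unfold boolLiminfAt
  split_ifs with h <;> simp [h]

theorem boolLiminfAt_congr {lam : Ordinal.{0}} {p q : Ordinal.{0} → Bool}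
    (h : ∀ i < lam, p i = q i) : boolLiminfAt lam p = boolLiminfAt lam q := by
  rw [Bool.eq_iff_iff]
  simp only [boolLiminfAt_eq_true]
  constructor <;> rintro ⟨γ, hγ, h1⟩ <;> refine ⟨γ, hγ, fun i h2 h3 => ?_⟩
  · rw [← h i h3]; exact h1 i h2 h3
  · rw [h i h3]; exact h1 i h2 h3

theorem natLiminfAt_congr {lam : Ordinal.{0}} {p q : Ordinal.{0} → ℕ}
    (h : ∀ i < lam, p i = q i) : natLiminfAt lam p = natLiminfAt lam q := by
  unfold natLiminfAt
  rw [liminfAt_congr (q := fun i => (q i : Ordinal))]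
  intro i hi
  rw [h i hi]

/-- eventually constant -/
theorem boolLiminfAt_ev {lam γ : Ordinal.{0}} {b : Ordinal.{0} → Bool} {v : Bool} (hγ : γ < lam)
    (h : ∀ i, γ ≤ i → i < lam → b i = v) : boolLiminfAt lam b = v := by
  cases v
  · rw [← Bool.not_eq_true, boolLiminfAt_eq_true]
    rintro ⟨γ', hγ', h'⟩
    have h1 := h (max γ γ') (le_max_left _ _) (max_lt hγ hγ')
    have h2 := h' (max γ γ') (le_max_right _ _) (max_lt hγ hγ')
    simp [h1] at h2
  · rw [boolLiminfAt_eq_true]; exact ⟨γ, hγ, h⟩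

theorem liminfAt_ev {lam γ v : Ordinal.{0}} {b : Ordinal.{0} → Ordinal.{0}} (hγ : γ < lam)
    (h : ∀ i, γ ≤ i → i < lam → b i = v) : liminfAt lam b = v := by
  apply eq_of_forall_lt_iff
  intro c
  rw [lt_liminfAt]
  constructor
  · rintro ⟨γ', hγ', h'⟩
    have h1 := h (max γ γ') (le_max_left _ _) (max_lt hγ hγ')
    have h2 := h' (max γ γ') (le_max_right _ _) (max_lt hγ hγ')
    rwa [h1] at h2
  · intro hc
    exact ⟨γ, hγ, fun i h1 h2 => by rw [h i h1 h2]; exact hc⟩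

theorem natLiminfAt_of_eq {lam : Ordinal.{0}} {s : Ordinal.{0} → ℕ} {n : ℕ}
    (h : liminfAt lam (fun i => (s i : Ordinal)) = n) : natLiminfAt lam s = n := by
  unfold natLiminfAt; rw [h]; simp

theorem exists_liminfAt_nat {lam : Ordinal.{0}} (h0 : 0 < lam) {s : Ordinal.{0} → ℕ} {B : ℕ}
    (hB : ∀ i < lam, s i < B) : ∃ n < B, liminfAt lam (fun i => (s i : Ordinal)) = n := by
  have h1 : liminfAt lam (fun i => (s i : Ordinal)) < B := by
    by_contra hc
    push Not at hc
    have hBp : B ≠ 0 := by have := hB 0 h0; omega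
    obtain ⟨b, rfl⟩ := Nat.exists_eq_succ_of_ne_zero hBp
    have h3 : (b : Ordinal) < liminfAt lam (fun i => (s i : Ordinal)) := by
      refine lt_of_lt_of_le ?_ hc
      exact_mod_cast Nat.lt_succ_self b
    rw [lt_liminfAt] at h3
    obtain ⟨γ, hγ, h⟩ := h3
    have h4 := h γ le_rfl hγ
    have h5 := hB γ hγ
    have h6 : b < s γ := by exact_mod_cast h4
    omega
  obtain ⟨n, hn⟩ := Ordinal.lt_omega0.1 (h1.trans (Ordinal.natCast_lt_omega0 B))
  refine ⟨n, ?_, hn⟩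
  rw [hn] at h1
  exact_mod_cast h1

theorem exists_interval {f : Ordinal.{0} → Ordinal.{0}} (hf : IsNormal f) (h0 : f 0 = 0)
    {lam i : Ordinal.{0}} (hi : i < f lam) :
    ∃ β < lam, f β ≤ i ∧ i < f (β + 1) := by
  obtain ⟨a, h1, h2⟩ := hf.exists_map_le_lt_map_succ (x := i) (by simp [h0])
  refine ⟨a, ?_, h1, ?_⟩
  · exact hf.strictMono.lt_iff_lt.1 (h1.trans_lt hi)
  · simpa using h2

theorem ord_cases (x : Ordinal.{0}) : x = 0 ∨ (∃ p, x = p + 1) ∨ IsSuccLimit x := by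
  induction x using Ordinal.limitRecOn with
  | zero => simp
  | add_one p _ => exact Or.inr (Or.inl ⟨p, rfl⟩)
  | limit x h _ => exact Or.inr (Or.inr h)

/-- time change for heads and states -/
theorem liminfAt_timechange {f g : Ordinal.{0} → Ordinal.{0}} (hf : IsNormal f) (h0 : f 0 = 0)
    (hg : IsNormal g) {lam : Ordinal.{0}} (hl : IsSuccLimit lam) {a b : Ordinal.{0} → Ordinal.{0}}
    (h1 : ∀ β < lam, a (f β) = g (b β))
    (h2 : ∀ β < lam, ∀ i, f β ≤ i → i < f (β + 1) → g (b β) ≤ a i ∨ g (b (β + 1)) ≤ a i) :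
    liminfAt (f lam) a = g (liminfAt lam b) := by
  have hlow : ∀ u, (∃ γ < lam, ∀ i, γ ≤ i → i < lam → u ≤ b i) →
      ∃ γ < f lam, ∀ i, γ ≤ i → i < f lam → g u ≤ a i := by
    rintro u ⟨γ, hγ, h⟩
    refine ⟨f γ, hf.strictMono hγ, fun i hi1 hi2 => ?_⟩
    obtain ⟨β, hβ, hb1, hb2⟩ := exists_interval hf h0 hi2
    have hγβ : γ ≤ β := by
      by_contra hc
      push Not at hc
      have : β + 1 ≤ γ := by simpa using Order.add_one_le_of_lt hc
      exact absurd (hf.monotone this) (not_le.2 (hi1.trans_lt hb2))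
    have hβ1 : β + 1 < lam := by simpa using hl.succ_lt hβ
    rcases h2 β hβ i hb1 hb2 with h3 | h3
    · exact (hg.monotone (h β hγβ hβ)).trans h3
    · exact (hg.monotone (h (β+1) (hγβ.trans (by simp)) hβ1)).trans h3
  apply eq_of_forall_lt_iff
  intro c
  constructor
  · intro hc
    obtain ⟨γ, hγ, h⟩ := lt_liminfAt.1 hc
    obtain ⟨γ', hγ', hγγ⟩ := (hf.lt_iff_exists_lt hl).1 hγ
    have hne : (b '' {i | γ' ≤ i ∧ i < lam}).Nonempty := ⟨_, γ', ⟨le_rfl, hγ'⟩, rfl⟩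
    obtain ⟨i, ⟨hi1, hi2⟩, hi3⟩ := csInf_mem hne
    have h4 : b i ≤ liminfAt lam b := by
      by_contra hc'
      push Not at hc'
      refine lt_irrefl _ (lt_liminfAt.2 ⟨γ', hγ', fun j hj1 hj2 => hc'.trans_le ?_⟩)
      rw [hi3]
      exact csInf_le' ⟨j, ⟨hj1, hj2⟩, rfl⟩
    have h5 := h (f i) (hγγ.le.trans (hf.monotone hi1)) (hf.strictMono hi2)
    rw [h1 i hi2] at h5
    exact h5.trans_le (hg.monotone h4)
  · intro hc
    rw [lt_liminfAt]
    suffices ∃ u, c < g u ∧ (∃ γ < lam, ∀ i, γ ≤ i → i < lam → u ≤ b i) by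
      obtain ⟨u, hu, h⟩ := this
      obtain ⟨γ, hγ, h⟩ := hlow u h
      exact ⟨γ, hγ, fun i hi1 hi2 => hu.trans_le (h i hi1 hi2)⟩
    rcases ord_cases (liminfAt lam b) with h | ⟨p, h⟩ | h
    · refine ⟨0, by rwa [h] at hc, 0, hl.bot_lt, fun _ _ _ => by simp⟩
    · refine ⟨p + 1, by rwa [h] at hc, ?_⟩
      obtain ⟨γ, hγ, h'⟩ := lt_liminfAt.1 (show p < liminfAt lam b by rw [h]; simp)
      exact ⟨γ, hγ, fun i hi1 hi2 => by simpa using Order.add_one_le_of_lt (h' i hi1 hi2)⟩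
    · obtain ⟨u, hu, h'⟩ := (hg.lt_iff_exists_lt h).1 hc
      obtain ⟨γ, hγ, h''⟩ := lt_liminfAt.1 hu
      exact ⟨u, h', γ, hγ, fun i hi1 hi2 => (h'' i hi1 hi2).le⟩

theorem boolLiminfAt_timechange {f : Ordinal.{0} → Ordinal.{0}} (hf : IsNormal f) (h0 : f 0 = 0)
    {lam : Ordinal.{0}} (hl : IsSuccLimit lam) {a b : Ordinal.{0} → Bool}
    (h1 : ∀ β < lam, a (f β) = b β)
    (h2 : ∀ β < lam, ∀ i, f β ≤ i → i < f (β + 1) → a i = b β ∨ a i = b (β + 1)) :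
    boolLiminfAt (f lam) a = boolLiminfAt lam b := by
  rw [Bool.eq_iff_iff]
  simp only [boolLiminfAt_eq_true]
  constructor
  · rintro ⟨γ, hγ, h⟩
    obtain ⟨γ', hγ', hγγ⟩ := (hf.lt_iff_exists_lt hl).1 hγ
    refine ⟨γ', hγ', fun i hi1 hi2 => ?_⟩
    rw [← h1 i hi2]
    exact h (f i) (hγγ.le.trans (hf.monotone hi1)) (hf.strictMono hi2)
  · rintro ⟨γ, hγ, h⟩
    refine ⟨f γ, hf.strictMono hγ, fun i hi1 hi2 => ?_⟩
    obtain ⟨β, hβ, hb1, hb2⟩ := exists_interval hf h0 hi2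
    have hγβ : γ ≤ β := by
      by_contra hc
      push Not at hc
      have : β + 1 ≤ γ := by simpa using Order.add_one_le_of_lt hc
      exact absurd (hf.monotone this) (not_le.2 (hi1.trans_lt hb2))
    have hβ1 : β + 1 < lam := by simpa using hl.succ_lt hβ
    rcases h2 β hβ i hb1 hb2 with h3 | h3
    · rw [h3]; exact h β hγβ hβ
    · rw [h3]; exact h (β+1) (hγβ.trans (by simp)) hβ1

theorem natLiminfAt_timechange {f : Ordinal.{0} → Ordinal.{0}} (hf : IsNormal f) (h0 : f 0 = 0)
    {K : ℕ} (hK : 0 < K) {lam : Ordinal.{0}} (hl : IsSuccLimit lam) {a b : Ordinal.{0} → ℕ}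
    {B : ℕ} (hB : ∀ β < lam, b β < B)
    (h1 : ∀ β < lam, a (f β) = K * b β)
    (h2 : ∀ β < lam, ∀ i, f β ≤ i → i < f (β + 1) → K * b β ≤ a i ∨ K * b (β + 1) ≤ a i) :
    natLiminfAt (f lam) a = K * natLiminfAt lam b := by
  obtain ⟨n, hn, hn'⟩ := exists_liminfAt_nat hl.bot_lt hB
  have hK' : (0 : Ordinal.{0}) < K := by exact_mod_cast hK
  have := liminfAt_timechange hf h0 (Ordinal.isNormal_mul_right hK') hl
    (a := fun i => (a i : Ordinal)) (b := fun i => (b i : Ordinal))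
    (fun β hβ => by simp only [h1 β hβ]; push_cast; rfl)
    (fun β hβ i hi1 hi2 => by
      rcases h2 β hβ i hi1 hi2 with h | h
      · left; exact_mod_cast h
      · right; exact_mod_cast h)
  rw [hn'] at this
  rw [natLiminfAt_of_eq hn', natLiminfAt_of_eq (n := K * n)]
  rw [this]; push_cast; rfl

theorem leftOf_add_one (p : Ordinal.{0}) : leftOf (p + 1) = p := by
  have h : ∃ q, p + 1 = q + 1 := ⟨p, rfl⟩
  unfold leftOf
  rw [dif_pos h]
  simp

theorem leftOf_zero : leftOf 0 = 0 := by
  unfold leftOf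
  rw [dif_neg]
  rintro ⟨p, hp⟩
  have h1 : (0 : Ordinal.{0}) < p + 1 := lt_of_le_of_lt (zero_le) (lt_add_one p)
  exact absurd hp h1.ne

theorem leftOf_limit {x : Ordinal.{0}} (h : IsSuccLimit x) : leftOf x = 0 := by
  unfold leftOf
  rw [dif_neg]
  rintro ⟨p, rfl⟩
  have := h.succ_lt (show p < p + 1 by simp)
  simp at this

theorem leftOf_le (x : Ordinal.{0}) : leftOf x ≤ x := by
  rcases ord_cases x with rfl | ⟨p, rfl⟩ | h
  · rw [leftOf_zero]
  · rw [leftOf_add_one]; simp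
  · rw [leftOf_limit h]; simp

theorem leftOf_eq_self {x : Ordinal.{0}} : leftOf x = x ↔ x = 0 := by
  rcases ord_cases x with rfl | ⟨p, rfl⟩ | h
  · simp [leftOf_zero]
  · rw [leftOf_add_one]
    simp
  · rw [leftOf_limit h, eq_comm]

theorem exists_equiv_zero (A : Type) [Finite A] (a : A) :
    ∃ n, ∃ e : A ≃ Fin (n + 1), e a = 0 := by
  obtain ⟨n, ⟨e⟩⟩ := Finite.exists_equiv_fin A
  cases n with
  | zero => exact (e a).elim0
  | succ n => exact ⟨n, e.trans (Equiv.swap (e a) 0), by simp⟩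

namespace OTMProgram
variable (P : OTMProgram)

theorem run_zero : P.run 0 = P.initConfig := Ordinal.limitRecOn_zero ..
theorem run_succ (o : Ordinal.{0}) : P.run (o + 1) = P.stepConfig (P.run o) :=
  Ordinal.limitRecOn_add_one ..
theorem run_limit {o : Ordinal.{0}} (h : IsSuccLimit o) :
    P.run o = P.limitConfig o (fun i _ => P.run i) :=
  Ordinal.limitRecOn_limit _ _ _ _ h

theorem run_limit_head {o : Ordinal.{0}} (h : IsSuccLimit o) (t) :
    (P.run o).head t = liminfAt o (fun i => (P.run i).head t) := by
  rw [run_limit P h]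
  exact liminfAt_congr (fun i hi => by simp [hi])

theorem run_limit_tape {o : Ordinal.{0}} (h : IsSuccLimit o) (t j) :
    (P.run o).tape t j = boolLiminfAt o (fun i => (P.run i).tape t j) := by
  rw [run_limit P h]
  exact boolLiminfAt_congr (fun i hi => by simp [hi])

theorem run_limit_state {o : Ordinal.{0}} (h : IsSuccLimit o) :
    ((P.run o).state : ℕ) = natLiminfAt o (fun i => ((P.run i).state : ℕ)) := by
  rw [run_limit P h]
  simp only [limitConfig]
  obtain ⟨n, hn, hn'⟩ := exists_liminfAt_nat (lam := o) h.bot_lt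
    (s := fun i => ((P.run i).state : ℕ)) (B := P.states + 1) (fun i _ => (P.run i).state.2)
  have e : natLiminfAt o (fun i => if h : i < o then ((P.run i).state : ℕ) else 0)
      = natLiminfAt o (fun i => ((P.run i).state : ℕ)) :=
    natLiminfAt_congr (fun i hi => by simp [hi])
  rw [e, natLiminfAt_of_eq hn', Nat.mod_eq_of_lt hn]

end OTMProgram

open Ordinal Order

/-- Machines with tracks: single head, cells carry finitely many bits (tracks `J`). -/
structure Mac (Q J : Type) where
  N : ℕ
  eQ : Q ≃ Fin (N + 1)
  q0 : Q
  hq0 : eQ q0 = 0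
  tr : Q → (J → Bool) → Q × (J → Bool) × Bool
  H : Q → Bool
  jf : J

structure MCfg (Q J : Type) where
  st : Q
  hd : Ordinal.{0}
  tp : Ordinal.{0} → J → Bool

namespace Mac
variable {Q J : Type} (m : Mac Q J)

noncomputable def step (c : MCfg Q J) : MCfg Q J :=
  { st := (m.tr c.st (c.tp c.hd)).1
    hd := if (m.tr c.st (c.tp c.hd)).2.2 then c.hd + 1 else leftOf c.hd
    tp := fun x => if x = c.hd then (m.tr c.st (c.tp c.hd)).2.1 else c.tp x }

def halting (c : MCfg Q J) : Prop := m.H c.st = true ∧ c.tp c.hd m.jf = false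

structure IsRun (r : Ordinal.{0} → MCfg Q J) : Prop where
  zero : r 0 = ⟨m.q0, 0, fun _ _ => false⟩
  succ : ∀ o, r (o + 1) = m.step (r o)
  lim_st : ∀ o, IsSuccLimit o →
    ((m.eQ (r o).st : Fin _) : ℕ) = natLiminfAt o (fun i => (m.eQ (r i).st : ℕ))
  lim_hd : ∀ o, IsSuccLimit o → (r o).hd = liminfAt o (fun i => (r i).hd)
  lim_tp : ∀ o, IsSuccLimit o → ∀ x j, (r o).tp x j = boolLiminfAt o (fun i => (r i).tp x j)

theorem exists_run : ∃ r, m.IsRun r := by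
  classical
  let L : Ordinal.{0} → (Ordinal.{0} → MCfg Q J) → MCfg Q J := fun o r =>
    { st := m.eQ.symm ⟨natLiminfAt o (fun i => (m.eQ (r i).st : ℕ)) % (m.N + 1),
        Nat.mod_lt _ (Nat.succ_pos _)⟩
      hd := liminfAt o (fun i => (r i).hd)
      tp := fun x j => boolLiminfAt o (fun i => (r i).tp x j) }
  have hL : ∀ o r r', (∀ i < o, r i = r' i) → L o r = L o r' := by
    intro o r r' h
    simp only [L, MCfg.mk.injEq]
    refine ⟨?_, ?_, ?_⟩
    · have := natLiminfAt_congr (lam := o) (p := fun i => (m.eQ (r i).st : ℕ))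
        (q := fun i => (m.eQ (r' i).st : ℕ)) (fun i hi => by simp only [h i hi])
      simp only [this]
    · exact liminfAt_congr (fun i hi => by rw [h i hi])
    · funext x j
      exact boolLiminfAt_congr (fun i hi => by rw [h i hi])
  let c0 : MCfg Q J := ⟨m.q0, 0, fun _ _ => false⟩
  let r : Ordinal.{0} → MCfg Q J := fun o =>
    Ordinal.limitRecOn (motive := fun _ => MCfg Q J) o c0 (fun _ ih => m.step ih)
      (fun lam _ ih => L lam (fun i => if h : i < lam then ih i h else c0))
  have hr0 : r 0 = c0 := Ordinal.limitRecOn_zero ..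
  have hrs : ∀ o, r (o + 1) = m.step (r o) := fun o => Ordinal.limitRecOn_add_one ..
  have hrl : ∀ o, IsSuccLimit o → r o = L o r := by
    intro o ho
    have : r o = L o (fun i => if h : i < o then r i else c0) :=
      Ordinal.limitRecOn_limit _ _ _ _ ho
    rw [this]
    exact hL _ _ _ (fun i hi => by simp [hi])
  refine ⟨r, hr0, hrs, ?_, ?_, ?_⟩
  · intro o ho
    rw [hrl o ho]
    simp only [L, Equiv.apply_symm_apply]
    obtain ⟨n, hn, hn'⟩ := exists_liminfAt_nat (lam := o) ho.bot_lt
      (s := fun i => (m.eQ (r i).st : ℕ)) (B := m.N + 1) (fun i _ => (m.eQ (r i).st).2)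
    rw [natLiminfAt_of_eq hn', Nat.mod_eq_of_lt hn]
  · intro o ho
    rw [hrl o ho]
  · intro o ho x j
    rw [hrl o ho]

end Mac

/-- coding data for the realization -/
structure Coding {Q J : Type} (m : Mac Q J) where
  n : ℕ
  eJ : J ≃ Fin (n + 1)
  hJ : eJ m.jf = 0
  K : ℕ
  eM : (Fin (3 * (n + 1)) × (J → Bool)) ≃ Fin (K + 1)
  hM : eM (0, fun _ => false) = 0

namespace Coding
variable {Q J : Type} {m : Mac Q J} (k : Coding m)

def code (q : Q) (i : Fin (3 * (k.n + 1))) (buf : J → Bool) : ℕ :=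
  (k.K + 1) * (m.eQ q : ℕ) + (k.eM (i, buf) : ℕ)

def top : ℕ := (k.K + 1) * (m.N + 1)

theorem code_lt (q i buf) : k.code q i buf < k.top := by
  have h1 := (m.eQ q).2
  have h2 := (k.eM (i, buf)).2
  unfold code top
  calc _ < (k.K + 1) * (m.eQ q : ℕ) + (k.K + 1) := by omega
    _ = (k.K + 1) * ((m.eQ q : ℕ) + 1) := by ring
    _ ≤ _ := Nat.mul_le_mul_left _ h1

theorem le_code (q i buf) : (k.K + 1) * (m.eQ q : ℕ) ≤ k.code q i buf := by
  unfold code; omega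

theorem code_zero (q) : k.code q 0 (fun _ => false) = (k.K + 1) * (m.eQ q : ℕ) := by
  unfold code; rw [k.hM]; simp

def jAt (i : ℕ) : J := k.eJ.symm (Fin.ofNat (k.n + 1) i)

theorem eJ_jAt {i : ℕ} (h : i < k.n + 1) : (k.eJ (k.jAt i) : ℕ) = i := by
  simp [jAt, Nat.mod_eq_of_lt h]

theorem jAt_eJ (j : J) : k.jAt (k.eJ j) = j := by
  simp [jAt]

/-- successor state -/
noncomputable def nxt (q : Q) (i : Fin (3 * (k.n + 1))) (buf : J → Bool) (b : Bool) : ℕ :=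
  open scoped Classical in
  if i.1 = 0 ∧ m.H q = true ∧ b = false then k.top
  else if h : i.1 + 1 < 3 * (k.n + 1) then
    k.code q ⟨i.1 + 1, h⟩ (if i.1 < k.n + 1 then Function.update buf (k.jAt i.1) b else buf)
  else k.code (m.tr q buf).1 0 (fun _ => false)

theorem nxt_lt (q i buf b) : k.nxt q i buf b < k.top + 1 := by
  unfold nxt
  split_ifs
  · omega
  all_goals exact (k.code_lt _ _ _).trans (Nat.lt_succ_self _)

def wrt (q : Q) (i : ℕ) (buf : J → Bool) (b : Bool) : Bool :=
  if k.n + 1 < i ∧ i ≤ 2 * (k.n + 1) then (m.tr q buf).2.1 (k.jAt (2 * (k.n + 1) - i)) else b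

def mov (q : Q) (i : ℕ) (buf : J → Bool) : Bool :=
  if i < k.n + 1 then true else if i < 2 * (k.n + 1) then false else (m.tr q buf).2.2

noncomputable def prog : OTMProgram where
  tapes := 1
  states := k.top
  trans := fun v rd =>
    if h : v.1 < k.top then
      let q : Q := m.eQ.symm ⟨v.1 / (k.K + 1), Nat.div_lt_of_lt_mul h⟩
      let mic := k.eM.symm ⟨v.1 % (k.K + 1), Nat.mod_lt _ (Nat.succ_pos _)⟩
      some (⟨k.nxt q mic.1 mic.2 (rd 0), k.nxt_lt _ _ _ _⟩,
        fun _ => k.wrt q mic.1 mic.2 (rd 0), fun _ => k.mov q mic.1 mic.2)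
    else none

def z : Fin k.prog.tapes := ⟨0, Nat.zero_lt_one⟩

theorem trans_top (v : Fin (k.prog.states + 1)) (hv : v.1 = k.top) (rd) :
    k.prog.trans v rd = none := by
  simp [prog, hv]

theorem trans_code (v : Fin (k.prog.states + 1)) {q i buf} (hv : v.1 = k.code q i buf) (rd) :
    k.prog.trans v rd = some (⟨k.nxt q i buf (rd k.z), k.nxt_lt _ _ _ _⟩,
        fun _ => k.wrt q i buf (rd k.z), fun _ => k.mov q i buf) := by
  have h : v.1 < k.top := by rw [hv]; exact k.code_lt _ _ _
  have hq : (m.eQ.symm ⟨v.1 / (k.K + 1), Nat.div_lt_of_lt_mul h⟩) = q := by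
    rw [Equiv.symm_apply_eq]
    ext
    simp only [hv, code]
    rw [Nat.mul_add_div (Nat.succ_pos _), Nat.div_eq_of_lt (k.eM (i, buf)).2, Nat.add_zero]
  have hm : (k.eM.symm ⟨v.1 % (k.K + 1), Nat.mod_lt _ (Nat.succ_pos _)⟩) = (i, buf) := by
    rw [Equiv.symm_apply_eq]
    ext
    simp only [hv, code]
    rw [Nat.mul_add_mod, Nat.mod_eq_of_lt (k.eM (i, buf)).2]
  simp only [prog]
  rw [dif_pos h]
  simp only [hq, hm]
  rfl

theorem stepConfig_code (C : OTMConfig k.prog) {q i buf} (hv : C.state.1 = k.code q i buf) :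
    k.prog.stepConfig C =
    { state := ⟨k.nxt q i buf (C.tape k.z (C.head k.z)), k.nxt_lt _ _ _ _⟩
      head := fun t => if k.mov q i buf then C.head t + 1 else leftOf (C.head t)
      tape := fun t p => if p = C.head t then k.wrt q i buf (C.tape k.z (C.head k.z))
        else C.tape t p } := by
  unfold OTMProgram.stepConfig
  rw [k.trans_code C.state hv]
  rfl

/-- block size as an ordinal -/
def D : Ordinal.{0} := ((k.n + 1 : ℕ) : Ordinal.{0})

theorem D_pos : 0 < k.D := by unfold D; exact_mod_cast Nat.succ_pos _

theorem D_inj {x y : Ordinal.{0}} {i j : ℕ} (hi : i < k.n + 1) (hj : j < k.n + 1) :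
    k.D * x + i = k.D * y + j ↔ x = y ∧ i = j := by
  constructor
  · intro h
    have hi' : (i : Ordinal.{0}) < k.D := by unfold D; exact_mod_cast hi
    have hj' : (j : Ordinal.{0}) < k.D := by unfold D; exact_mod_cast hj
    have h1 := congrArg (· / k.D) h
    have h2 := congrArg (· % k.D) h
    simp only [Ordinal.mul_add_div _ k.D_pos.ne', Ordinal.mul_add_mod_self,
      Ordinal.div_eq_zero_of_lt hi', Ordinal.div_eq_zero_of_lt hj', Ordinal.mod_eq_of_lt hi',
      Ordinal.mod_eq_of_lt hj', add_zero] at h1 h2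
    exact ⟨h1, by exact_mod_cast h2⟩
  · rintro ⟨rfl, rfl⟩; rfl

theorem leftOf_add_nat (a : Ordinal.{0}) {n : ℕ} (h : 0 < n) :
    leftOf (a + n) = a + (n - 1 : ℕ) := by
  obtain ⟨l, rfl⟩ := Nat.exists_eq_succ_of_ne_zero h.ne'
  rw [Nat.succ_sub_one, Nat.succ_eq_add_one, Nat.cast_add, ← add_assoc, Nat.cast_one,
    leftOf_add_one]

theorem iter_leftOf_add_nat (a : Ordinal.{0}) {n l : ℕ} (h : l ≤ n) :
    leftOf^[l] (a + n) = a + (n - l : ℕ) := by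
  induction l with
  | zero => simp
  | succ l ih =>
    rw [Function.iterate_succ_apply', ih (by omega), leftOf_add_nat _ (by omega)]
    congr 2

theorem iter_leftOf_zero (l : ℕ) : leftOf^[l] 0 = 0 := by
  induction l with
  | zero => rfl
  | succ l ih => rw [Function.iterate_succ_apply', ih, leftOf_zero]

theorem D_succ (p : Ordinal.{0}) : k.D * (p + 1) = k.D * p + (k.n + 1 : ℕ) := by
  rw [mul_add_one]; rfl

theorem iter_leftOf_D (x : Ordinal.{0}) : leftOf^[k.n + 1] (k.D * x) = k.D * leftOf x := by
  rcases ord_cases x with rfl | ⟨p, rfl⟩ | h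
  · rw [mul_zero, iter_leftOf_zero, leftOf_zero, mul_zero]
  · rw [D_succ, iter_leftOf_add_nat _ le_rfl, leftOf_add_one]; simp
  · rw [Function.iterate_succ_apply, leftOf_limit (Ordinal.isSuccLimit_mul_right k.D_pos h),
      iter_leftOf_zero, leftOf_limit h, mul_zero]

theorem le_iter_leftOf_D (x : Ordinal.{0}) {l : ℕ} (hl : l ≤ k.n + 1) :
    k.D * leftOf x ≤ leftOf^[l] (k.D * x) := by
  rcases ord_cases x with rfl | ⟨p, rfl⟩ | h
  · rw [mul_zero, iter_leftOf_zero, leftOf_zero, mul_zero]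
  · rw [D_succ, iter_leftOf_add_nat _ hl, leftOf_add_one]; simp
  · rw [leftOf_limit h, mul_zero]; simp

noncomputable def pos (x : Ordinal.{0}) (dir : Bool) (i : ℕ) : Ordinal.{0} :=
  if i ≤ k.n + 1 then k.D * x + i
  else if i ≤ 2 * (k.n + 1) then k.D * x + (2 * (k.n + 1) - i : ℕ)
  else if dir then k.D * x + (i - 2 * (k.n + 1) : ℕ)
  else leftOf^[i - 2 * (k.n + 1)] (k.D * x)

/-- Intermediate configuration. -/
structure Mid (c : MCfg Q J) (i : Fin (3 * (k.n + 1))) (C : OTMConfig k.prog) : Prop where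
  st : C.state.1 = k.code c.st i (fun j => if (k.eJ j : ℕ) < i then c.tp c.hd j else false)
  hd : C.head k.z = k.pos c.hd (m.tr c.st (c.tp c.hd)).2.2 i
  tp : ∀ y j, C.tape k.z (k.D * y + (k.eJ j : ℕ)) =
    if y = c.hd ∧ 2 * (k.n + 1) < (k.eJ j : ℕ) + i then (m.step c).tp y j else c.tp y j

theorem pos_step (x : Ordinal.{0}) (dir : Bool) (i : ℕ) (q : Q) (buf) (hi : i < 3 * (k.n + 1))
    (hd : k.n + 1 ≤ i → (m.tr q buf).2.2 = dir) :
    (if k.mov q i buf then k.pos x dir i + 1 else leftOf (k.pos x dir i)) =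
      k.pos x dir (i + 1) := by
  unfold mov pos
  by_cases h1 : i < k.n + 1
  · simp only [h1, if_true, h1.le, Nat.succ_le_of_lt h1]
    push_cast; rw [add_assoc]
  rw [if_neg h1]
  have h1' : ¬ i + 1 ≤ k.n + 1 := by omega
  rw [if_neg h1']
  specialize hd (by omega)
  by_cases h2 : i < 2 * (k.n + 1)
  · have h2' : i + 1 ≤ 2 * (k.n + 1) := by omega
    simp only [h2, h2.le, h2', if_true, Bool.false_eq_true, if_false]
    by_cases h3 : i ≤ k.n + 1
    · rw [if_pos h3, leftOf_add_nat _ (by omega)]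
      congr 2; omega
    · rw [if_neg h3, leftOf_add_nat _ (by omega)]
      congr 2
  · have h2' : ¬ (i + 1 ≤ 2 * (k.n + 1)) := by omega
    have h3 : ¬ (i ≤ k.n + 1) := by omega
    rw [if_neg h2, if_neg h2', if_neg h3, hd]
    by_cases h4 : i ≤ 2 * (k.n + 1)
    · have : i = 2 * (k.n + 1) := by omega
      subst this
      cases dir <;> simp
    · rw [if_neg h4]
      have h5 : i + 1 - 2 * (k.n + 1) = (i - 2 * (k.n + 1)) + 1 := by omega
      cases dir
      · simp only [Bool.false_eq_true, if_false, h5]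
        rw [Function.iterate_succ_apply']
      · simp only [if_true, h5]
        push_cast; rw [add_assoc]

theorem mid_buf (c : MCfg Q J) {i : ℕ} (h : k.n + 1 ≤ i) :
    (fun j => if (k.eJ j : ℕ) < i then c.tp c.hd j else false) = c.tp c.hd := by
  funext j
  rw [if_pos (lt_of_lt_of_le (k.eJ j).2 h)]

theorem mid_step {c : MCfg Q J} {i : Fin (3 * (k.n + 1))} {C : OTMConfig k.prog}
    (hm : k.Mid c i C) (hnh : i.1 = 0 → ¬ m.halting c) :
    (∃ h : i.1 + 1 < 3 * (k.n + 1), k.Mid c ⟨i.1 + 1, h⟩ (k.prog.stepConfig C)) ∨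
    (i.1 + 1 = 3 * (k.n + 1) ∧ k.Mid (m.step c) 0 (k.prog.stepConfig C)) := by
  classical
  have hstep := k.stepConfig_code C hm.st
  set buf : J → Bool := (fun j => if (k.eJ j : ℕ) < i then c.tp c.hd j else false) with hbuf
  set b := C.tape k.z (C.head k.z) with hb
  have hbufd : k.n + 1 ≤ i.1 → buf = c.tp c.hd := fun h => k.mid_buf c h
  -- the bit read in the reading phase
  have hbread : i.1 < k.n + 1 → b = c.tp c.hd (k.jAt i) := by
    intro h
    have h1 := hm.tp c.hd (k.jAt i)
    rw [k.eJ_jAt h, if_neg (by omega)] at h1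
    rw [hb, hm.hd, pos, if_pos h.le, h1]
  have hnt : ¬ (i.1 = 0 ∧ m.H c.st = true ∧ b = false) := by
    rintro ⟨h0, h1, h2⟩
    refine hnh h0 ⟨h1, ?_⟩
    rw [← h2, hbread (by omega)]
    congr 1
    rw [← k.jAt_eJ m.jf, k.hJ, h0]; rfl
  have hhead : (k.prog.stepConfig C).head k.z =
      k.pos c.hd (m.tr c.st (c.tp c.hd)).2.2 (i.1 + 1) := by
    rw [hstep]
    simp only
    rw [hm.hd]
    exact k.pos_step c.hd _ i.1 c.st buf i.2 (fun h => by rw [hbufd h])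
  have htape : ∀ y j, (k.prog.stepConfig C).tape k.z (k.D * y + (k.eJ j : ℕ)) =
      if y = c.hd ∧ 2 * (k.n + 1) < (k.eJ j : ℕ) + (i.1 + 1) then (m.step c).tp y j
        else c.tp y j := by
    intro y j
    rw [hstep]
    simp only
    have hj := (k.eJ j).2
    by_cases hw : k.n + 1 < i.1 ∧ i.1 ≤ 2 * (k.n + 1)
    · have hpos : C.head k.z = k.D * c.hd + (2 * (k.n + 1) - i.1 : ℕ) := by
        rw [hm.hd, pos, if_neg (by omega), if_pos hw.2]
      rw [hpos, wrt, if_pos hw]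
      simp only [k.D_inj hj (show 2 * (k.n + 1) - i.1 < k.n + 1 by omega)]
      by_cases he : y = c.hd ∧ (k.eJ j : ℕ) = 2 * (k.n + 1) - i.1
      · rw [if_pos he, if_pos ⟨he.1, by omega⟩, ← he.2, k.jAt_eJ, hbufd (by omega)]
        simp [Mac.step, he.1]
      · rw [if_neg he, hm.tp]
        congr 1
        apply propext
        constructor
        · rintro ⟨h1, h2⟩; exact ⟨h1, by omega⟩
        · rintro ⟨h1, h2⟩
          refine ⟨h1, ?_⟩
          have : (k.eJ j : ℕ) ≠ 2 * (k.n + 1) - i.1 := fun h => he ⟨h1, h⟩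
          omega
    · rw [wrt, if_neg hw]
      have : (if k.D * y + ((k.eJ j : ℕ) : Ordinal.{0}) = C.head k.z then b
          else C.tape k.z (k.D * y + ((k.eJ j : ℕ) : Ordinal.{0}))) =
          C.tape k.z (k.D * y + ((k.eJ j : ℕ) : Ordinal.{0})) := by
        split_ifs with h
        · rw [hb, h]
        · rfl
      refine this.trans ?_
      rw [hm.tp]
      congr 1
      apply propext
      constructor
      · rintro ⟨h1, h2⟩; exact ⟨h1, by omega⟩
      · rintro ⟨h1, h2⟩; exact ⟨h1, by omega⟩
  by_cases hlt : i.1 + 1 < 3 * (k.n + 1)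
  · left
    refine ⟨hlt, ?_, hhead, htape⟩
    rw [hstep]
    simp only [nxt, if_neg hnt, dif_pos hlt]
    congr 1
    funext j
    split_ifs with h1 h2 h2
    · by_cases hj : j = k.jAt i
      · subst hj; rw [Function.update_self, hbread h1]
      · rw [Function.update_of_ne hj, hbuf]
        have : (k.eJ j : ℕ) ≠ i := by
          intro h; apply hj; rw [← k.jAt_eJ j, h]
        simp only
        rw [if_pos (by omega)]
    · have hj : j ≠ k.jAt i := by
        rintro rfl; rw [k.eJ_jAt h1] at h2; omega
      rw [Function.update_of_ne hj, hbuf]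
      simp only
      rw [if_neg (by omega)]
    · rw [hbufd (by omega)]
    · have := (k.eJ j).2; omega
  · right
    have hi : i.1 + 1 = 3 * (k.n + 1) := by have := i.2; omega
    refine ⟨hi, ?_, ?_, ?_⟩
    · rw [hstep]
      simp only [nxt, if_neg hnt, dif_neg hlt]
      rw [hbufd (by omega)]
      congr 1
    · rw [hhead, hi, pos, if_neg (by omega), if_neg (by omega)]
      have e : 3 * (k.n + 1) - 2 * (k.n + 1) = k.n + 1 := by omega
      rw [e, k.iter_leftOf_D, pos, if_pos (show ((0 : Fin (3 * (k.n + 1))) : ℕ) ≤ k.n + 1 from Nat.zero_le _), ← k.D_succ]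
      have h0 : ((((0 : Fin (3 * (k.n + 1))) : ℕ) : ℕ) : Ordinal.{0}) = 0 := by simp
      rw [h0, add_zero]
      simp only [Mac.step]
      split_ifs <;> rfl
    · intro y j
      rw [htape, hi]
      have hj := (k.eJ j).2
      by_cases hy : y = c.hd
      · rw [if_pos ⟨hy, by omega⟩, if_neg (by simp; omega)]
      · rw [if_neg (by tauto), if_neg (by simp; omega)]
        simp [Mac.step, hy]

end Coding

open Ordinal Order

namespace Coding
variable {Q J : Type} {m : Mac Q J} (k : Coding m)

def T : Ordinal.{0} := ((3 * (k.n + 1) : ℕ) : Ordinal.{0})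

theorem T_pos : 0 < k.T := by unfold T; exact_mod_cast Nat.succ_pos _

theorem mid_all {c : MCfg Q J} {τ : Ordinal.{0}} (h0 : k.Mid c 0 (k.prog.run τ))
    (hnh : ¬ m.halting c) :
    (∀ i : Fin (3 * (k.n + 1)), k.Mid c i (k.prog.run (τ + (i : ℕ)))) ∧
      k.Mid (m.step c) 0 (k.prog.run (τ + k.T)) := by
  have h1 : ∀ i : ℕ, ∀ h : i < 3 * (k.n + 1), k.Mid c ⟨i, h⟩ (k.prog.run (τ + i)) := by
    intro i
    induction i with
    | zero => intro h; simpa using h0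
    | succ i ih =>
      intro h
      rcases k.mid_step (ih (by omega)) (fun _ => hnh) with ⟨h', h2⟩ | ⟨h', h2⟩
      · rw [← OTMProgram.run_succ] at h2
        push_cast
        rw [← add_assoc]
        exact h2
      · simp only at h'; omega
  refine ⟨fun i => h1 i i.2, ?_⟩
  rcases k.mid_step (h1 (3 * k.n + 2) (by omega)) (fun _ => hnh) with ⟨h', h2⟩ | ⟨h', h2⟩
  · simp only at h'; omega
  · rw [← OTMProgram.run_succ] at h2
    have : k.T = ((3 * k.n + 2 : ℕ) : Ordinal.{0}) + 1 := by
      unfold T; rw [show 3 * (k.n + 1) = 3 * k.n + 2 + 1 by ring]; push_cast; rfl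
    rw [this, ← add_assoc]
    exact h2

theorem mid_zero_st {c : MCfg Q J} {C : OTMConfig k.prog} (h : k.Mid c 0 C) :
    C.state.1 = (k.K + 1) * (m.eQ c.st : ℕ) := by
  rw [h.st, ← k.code_zero]
  rfl

theorem mid_zero_hd {c : MCfg Q J} {C : OTMConfig k.prog} (h : k.Mid c 0 C) :
    C.head k.z = k.D * c.hd := by
  rw [h.hd, pos, if_pos (show ((0 : Fin (3 * (k.n + 1))) : ℕ) ≤ k.n + 1 from Nat.zero_le _)]
  simp

theorem mid_zero_tp {c : MCfg Q J} {C : OTMConfig k.prog} (h : k.Mid c 0 C) (y j) :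
    C.tape k.z (k.D * y + (k.eJ j : ℕ)) = c.tp y j := by
  rw [h.tp, if_neg]
  rintro ⟨-, h⟩
  have := (k.eJ j).2
  simp at h
  omega

theorem mid_zero_mk {c : MCfg Q J} {C : OTMConfig k.prog}
    (h1 : C.state.1 = (k.K + 1) * (m.eQ c.st : ℕ))
    (h2 : C.head k.z = k.D * c.hd)
    (h3 : ∀ y j, C.tape k.z (k.D * y + (k.eJ j : ℕ)) = c.tp y j) : k.Mid c 0 C := by
  refine ⟨?_, ?_, ?_⟩
  · rw [h1, ← k.code_zero]; rfl
  · rw [h2, pos, if_pos (show ((0 : Fin (3 * (k.n + 1))) : ℕ) ≤ k.n + 1 from Nat.zero_le _)]; simp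
  · intro y j
    rw [h3, if_neg]
    rintro ⟨-, h⟩
    have := (k.eJ j).2
    simp at h
    omega

theorem mid_hd_le {c : MCfg Q J} {i} {C : OTMConfig k.prog} (h : k.Mid c i C) :
    k.D * c.hd ≤ C.head k.z ∨ k.D * (m.step c).hd ≤ C.head k.z := by
  rw [h.hd, pos]
  have hi := i.2
  split_ifs with h1 h2 h3
  · left; simp
  · left; simp
  · left; simp
  · right
    simp only [Mac.step, if_neg h3]
    exact k.le_iter_leftOf_D _ (by omega)

theorem mid_tp_or {c : MCfg Q J} {i} {C : OTMConfig k.prog} (h : k.Mid c i C) (y j) :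
    C.tape k.z (k.D * y + (k.eJ j : ℕ)) = c.tp y j ∨
    C.tape k.z (k.D * y + (k.eJ j : ℕ)) = (m.step c).tp y j := by
  rw [h.tp]
  split_ifs <;> simp

theorem interval_T {β i : Ordinal.{0}} (h1 : k.T * β ≤ i) (h2 : i < k.T * (β + 1)) :
    ∃ l : Fin (3 * (k.n + 1)), i = k.T * β + (l : ℕ) := by
  rw [mul_add_one] at h2
  obtain ⟨δ, rfl⟩ := exists_add_of_le h1
  have h3 : δ < k.T := by simpa using h2
  obtain ⟨l, rfl⟩ := Ordinal.lt_omega0.1 (h3.trans (Ordinal.natCast_lt_omega0 _))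
  refine ⟨⟨l, ?_⟩, rfl⟩
  unfold T at h3
  exact_mod_cast h3

theorem mid_run {r : Ordinal.{0} → MCfg Q J} (hr : m.IsRun r) {θ : Ordinal.{0}}
    (hn : ∀ τ < θ, ¬ m.halting (r τ)) :
    ∀ τ ≤ θ, k.Mid (r τ) 0 (k.prog.run (k.T * τ)) := by
  intro τ
  induction τ using Ordinal.limitRecOn with
  | zero =>
    intro _
    rw [mul_zero, OTMProgram.run_zero, hr.zero]
    apply k.mid_zero_mk
    · simp [OTMProgram.initConfig, m.hq0]
    · simp [OTMProgram.initConfig]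
    · intro y j; rfl
  | add_one τ ih =>
    intro h
    have hlt : τ < θ := lt_of_lt_of_le (lt_add_one τ) h
    rw [hr.succ, show k.T * (τ + 1) = k.T * τ + k.T from mul_add_one _ _]
    exact (k.mid_all (ih hlt.le) (hn _ hlt)).2
  | limit lam hl ih =>
    intro h
    have hN := Ordinal.isNormal_mul_right k.T_pos
    have hlT : IsSuccLimit (k.T * lam) := hN.map_isSuccLimit hl
    have hmid : ∀ β < lam, ∀ i, k.T * β ≤ i → i < k.T * (β + 1) →
        ∃ l, k.Mid (r β) l (k.prog.run i) := by
      intro β hβ i h1 h2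
      obtain ⟨l, rfl⟩ := k.interval_T h1 h2
      exact ⟨l, (k.mid_all (ih β hβ (hβ.le.trans h)) (hn _ (hβ.trans_le h))).1 l⟩
    apply k.mid_zero_mk
    · rw [OTMProgram.run_limit_state _ hlT, hr.lim_st _ hl]
      refine natLiminfAt_timechange hN (mul_zero _) (Nat.succ_pos _) hl (B := m.N + 1)
        (fun β _ => (m.eQ (r β).st).2) ?_ ?_
      · intro β hβ
        exact k.mid_zero_st (ih β hβ (hβ.le.trans h))
      · intro β hβ i h1 h2
        obtain ⟨l, hl⟩ := hmid β hβ i h1 h2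
        left
        rw [hl.st]
        exact k.le_code _ _ _
    · rw [OTMProgram.run_limit_head _ hlT, hr.lim_hd _ hl]
      refine liminfAt_timechange hN (mul_zero _) (Ordinal.isNormal_mul_right k.D_pos) hl ?_ ?_
      · intro β hβ
        exact k.mid_zero_hd (ih β hβ (hβ.le.trans h))
      · intro β hβ i h1 h2
        obtain ⟨l, hl⟩ := hmid β hβ i h1 h2
        rw [hr.succ]
        exact k.mid_hd_le hl
    · intro y j
      rw [OTMProgram.run_limit_tape _ hlT, hr.lim_tp _ hl]
      refine boolLiminfAt_timechange hN (mul_zero _) hl ?_ ?_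
      · intro β hβ
        exact k.mid_zero_tp (ih β hβ (hβ.le.trans h)) y j
      · intro β hβ i h1 h2
        obtain ⟨l, hl⟩ := hmid β hβ i h1 h2
        rw [hr.succ]
        exact k.mid_tp_or hl y j

theorem not_halted_mid {c : MCfg Q J} {i} {τ : Ordinal.{0}} (h : k.Mid c i (k.prog.run τ)) :
    ¬ k.prog.haltedAt τ := by
  unfold OTMProgram.haltedAt
  rw [k.trans_code _ h.st]
  simp

theorem haltsAt {r : Ordinal.{0} → MCfg Q J} (hr : m.IsRun r) {θ : Ordinal.{0}}
    (hh : m.halting (r θ)) (hn : ∀ τ < θ, ¬ m.halting (r τ)) :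
    k.prog.haltsAt (k.T * θ + 1) := by
  have hm := k.mid_run hr hn
  constructor
  · unfold OTMProgram.haltedAt
    apply k.trans_top
    rw [OTMProgram.run_succ, k.stepConfig_code _ (hm θ le_rfl).st]
    simp only [nxt]
    rw [if_pos]
    refine ⟨rfl, hh.1, ?_⟩
    rw [← hh.2, k.mid_zero_hd (hm θ le_rfl), ← k.mid_zero_tp (hm θ le_rfl), k.hJ]
    simp
  · intro σ hσ
    have hσ' : σ ≤ k.T * θ := by simpa using hσ
    rcases hσ'.eq_or_lt with rfl | hlt
    · exact k.not_halted_mid (hm θ le_rfl)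
    · obtain ⟨β, hβ, h1, h2⟩ := exists_interval (Ordinal.isNormal_mul_right k.T_pos)
        (mul_zero _) hlt
      obtain ⟨l, rfl⟩ := k.interval_T h1 h2
      exact k.not_halted_mid ((k.mid_all (hm β hβ.le) (hn _ hβ)).1 l)

end Coding

theorem Mac.realize {Q J : Type} [Finite J] (m : Mac Q J) {r : Ordinal.{0} → MCfg Q J}
    (hr : m.IsRun r) {θ : Ordinal.{0}}
    (hh : m.halting (r θ)) (hn : ∀ τ < θ, ¬ m.halting (r τ))
    (hθ : ∀ n : ℕ, 0 < n → (n : Ordinal.{0}) * θ = θ) :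
    ∃ P : OTMProgram, P.tapes = 1 ∧ P.haltsAt (θ + 1) := by
  obtain ⟨n, eJ, hJ⟩ := exists_equiv_zero J m.jf
  obtain ⟨K, eM, hM⟩ := exists_equiv_zero (Fin (3 * (n + 1)) × (J → Bool)) (0, fun _ => false)
  let k : Coding m := ⟨n, eJ, hJ, K, eM, hM⟩
  refine ⟨k.prog, rfl, ?_⟩
  have := k.haltsAt hr hh hn
  rwa [show k.T * θ = θ from hθ _ (by omega)] at this

open Ordinal Order

theorem MCfg.ext' {Q J : Type} {c d : MCfg Q J} (h1 : c.st = d.st) (h2 : c.hd = d.hd)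
    (h3 : ∀ x j, c.tp x j = d.tp x j) : c = d := by
  cases c; cases d
  simp only [MCfg.mk.injEq]
  exact ⟨h1, h2, funext fun x => funext fun j => h3 x j⟩

namespace Mac
variable {Q J : Type} (m : Mac Q J)

/-- `c` evolves into `c'` in `δ` steps, with `I` holding at all times before the end. -/
def Reach (I : MCfg Q J → Prop) (c : MCfg Q J) (δ : Ordinal.{0}) (c' : MCfg Q J) : Prop :=
  ∀ r, m.IsRun r → ∀ τ, r τ = c → r (τ + δ) = c' ∧ ∀ i < δ, I (r (τ + i))

variable {m} {I I' : MCfg Q J → Prop}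

theorem Reach.mono {c c' : MCfg Q J} {δ : Ordinal.{0}} (h : m.Reach I c δ c')
    (hI : ∀ d, I d → I' d) : m.Reach I' c δ c' := by
  intro r hr τ hτ
  obtain ⟨h1, h2⟩ := h r hr τ hτ
  exact ⟨h1, fun i hi => hI _ (h2 i hi)⟩

theorem Reach.refl (c : MCfg Q J) : m.Reach I c 0 c := by
  intro r hr τ hτ
  refine ⟨by rw [add_zero, hτ], fun i hi => absurd hi (not_lt.2 zero_le)⟩

theorem Reach.step {c c' : MCfg Q J} (hI : I c) (h : m.step c = c') : m.Reach I c 1 c' := by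
  intro r hr τ hτ
  refine ⟨by rw [hr.succ, hτ, h], fun i hi => ?_⟩
  rw [Order.lt_one_iff.1 hi, add_zero, hτ]
  exact hI

theorem Reach.trans {c c' c'' : MCfg Q J} {δ δ' : Ordinal.{0}} (h : m.Reach I c δ c')
    (h' : m.Reach I c' δ' c'') : m.Reach I c (δ + δ') c'' := by
  intro r hr τ hτ
  obtain ⟨h1, h2⟩ := h r hr τ hτ
  obtain ⟨h3, h4⟩ := h' r hr _ h1
  refine ⟨by rw [← add_assoc, h3], fun i hi => ?_⟩
  rcases lt_or_ge i δ with hlt | hge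
  · exact h2 i hlt
  · obtain ⟨i', rfl⟩ := exists_add_of_le hge
    rw [← add_assoc]
    exact h4 _ (lt_of_add_lt_add_left hi)

theorem Reach.scan {q : Q} {a : Ordinal.{0}} {T : Ordinal.{0} → Ordinal.{0} → J → Bool}
    (X : Ordinal.{0})
    (hI : ∀ x < X, I ⟨q, a + x, T x⟩)
    (hs : ∀ x < X, m.step ⟨q, a + x, T x⟩ = ⟨q, a + x + 1, T (x + 1)⟩)
    (hl : ∀ x ≤ X, IsSuccLimit x → ∀ z j, ∃ γ < x, ∀ i, γ ≤ i → i < x → T i z j = T x z j) :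
    m.Reach I ⟨q, a, T 0⟩ X ⟨q, a + X, T X⟩ := by
  intro r hr τ hτ
  have key : ∀ x ≤ X, r (τ + x) = ⟨q, a + x, T x⟩ := by
    intro x
    induction x using Ordinal.limitRecOn with
    | zero => intro _; rw [add_zero, add_zero, hτ]
    | add_one x ih =>
      intro hx
      have hx' : x < X := lt_of_lt_of_le (lt_add_one x) hx
      rw [← add_assoc, hr.succ, ih hx'.le, hs x hx', ← add_assoc]
    | limit x hx ih =>
      intro hxX
      have hlim : IsSuccLimit (τ + x) := isSuccLimit_add _ hx
      have ih' : ∀ i, τ ≤ i → i < τ + x → ∃ i', i = τ + i' ∧ i' < x ∧ r i = ⟨q, a + i', T i'⟩ := by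
        intro i h1 h2
        obtain ⟨i', rfl⟩ := exists_add_of_le h1
        have h3 := lt_of_add_lt_add_left h2
        exact ⟨i', rfl, h3, ih i' h3 (h3.le.trans hxX)⟩
      have hτl : τ < τ + x := by
        conv_lhs => rw [← add_zero τ]
        exact (add_lt_add_iff_left τ).2 hx.bot_lt
      apply MCfg.ext'
      · apply m.eQ.injective
        apply Fin.ext
        rw [hr.lim_st _ hlim]
        apply natLiminfAt_of_eq
        apply liminfAt_ev hτl
        intro i h1 h2
        obtain ⟨i', -, -, h⟩ := ih' i h1 h2
        rw [h]
      · rw [hr.lim_hd _ hlim]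
        apply eq_of_forall_lt_iff
        intro c
        rw [lt_liminfAt]
        constructor
        · rintro ⟨γ, hγ, h⟩
          obtain ⟨i', -, h1, h2⟩ := ih' (max τ γ) (le_max_left _ _) (max_lt hτl hγ)
          have := h (max τ γ) (le_max_right _ _) (max_lt hτl hγ)
          rw [h2] at this
          exact this.trans ((add_lt_add_iff_left a).2 h1)
        · intro h
          obtain ⟨y, hy, hcy⟩ := (lt_add_iff_of_isSuccLimit hx).1 h
          refine ⟨τ + y, (add_lt_add_iff_left τ).2 hy, fun i h1 h2 => ?_⟩
          obtain ⟨i', rfl, h3, h4⟩ := ih' i (le_self_add.trans h1) h2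
          rw [h4]
          have : y ≤ i' := le_of_add_le_add_left h1
          exact hcy.trans_le ((add_le_add_iff_left a).2 this)
      · intro z j
        rw [hr.lim_tp _ hlim]
        obtain ⟨γ, hγ, h⟩ := hl x hxX hx z j
        apply boolLiminfAt_ev (γ := τ + γ) ((add_lt_add_iff_left τ).2 hγ)
        intro i h1 h2
        obtain ⟨i', rfl, h3, h4⟩ := ih' i (le_self_add.trans h1) h2
        rw [h4]
        exact h i' (le_of_add_le_add_left h1) h3
  refine ⟨key X le_rfl, fun i hi => ?_⟩
  rw [key i hi.le]
  exact hI i hi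

/-- scanning right over a fixed tape -/
theorem Reach.scan_const {q : Q} {T : Ordinal.{0} → J → Bool}
    (X : Ordinal.{0})
    (hI : ∀ x < X, I ⟨q, x, T⟩)
    (hs : ∀ x < X, m.tr q (T x) = (q, T x, true)) :
    m.Reach I ⟨q, 0, T⟩ X ⟨q, X, T⟩ := by
  have := Reach.scan (m := m) (I := I) (q := q) (a := 0) (T := fun _ => T) X
    (by simpa using hI)
    (by
      intro x hx
      simp only [zero_add]
      apply MCfg.ext'
      · simp [Mac.step, hs x hx]
      · simp [Mac.step, hs x hx]
      · intro y j
        simp only [Mac.step, hs x hx]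
        split_ifs with h
        · rw [h]
        · rfl)
    (fun x _ hx z j => ⟨0, hx.bot_lt, fun _ _ _ => rfl⟩)
  simpa using this

/-- going back to the origin -/
theorem Reach.ret {q : Q} {T : Ordinal.{0} → J → Bool}
    (hI : ∀ x, I ⟨q, x, T⟩)
    (hs : ∀ x, x ≠ 0 → m.tr q (T x) = (q, T x, false)) (x : Ordinal.{0}) :
    ∃ n : ℕ, (n : Ordinal.{0}) ≤ x ∧ m.Reach I ⟨q, x, T⟩ n ⟨q, 0, T⟩ := by
  induction x using WellFoundedLT.induction with
  | ind x ih =>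
    by_cases hx : x = 0
    · subst hx
      exact ⟨0, by simp, by simpa using Reach.refl _⟩
    · have hlt : leftOf x < x := lt_of_le_of_ne (leftOf_le x) (fun h => hx (leftOf_eq_self.1 h))
      have hst : m.step ⟨q, x, T⟩ = ⟨q, leftOf x, T⟩ := by
        apply MCfg.ext'
        · simp [Mac.step, hs x hx]
        · simp [Mac.step, hs x hx]
        · intro y j
          simp only [Mac.step, hs x hx]
          split_ifs with h
          · rw [h]
          · rfl
      obtain ⟨n, hn, hr⟩ := ih _ hlt
      refine ⟨1 + n, ?_, ?_⟩
      · rw [add_comm]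
        push_cast
        exact Order.add_one_le_of_lt (hn.trans_lt hlt)
      · push_cast
        exact (Reach.step (hI x) hst).trans hr

end Mac

open Ordinal Order

/-- Tracks of the simulating machine. -/
inductive Trk (k : ℕ) : Type
  | F : Trk k
  | Z : Trk k
  | S : Trk k
  | sym (t : Fin k) : Trk k
  | A (t : Fin k) : Trk k

theorem Trk.finite (k : ℕ) : Finite (Trk k) := by
  refine Finite.of_injective (β := Fin 5 × Option (Fin k)) (fun
    | .F => (0, none)
    | .Z => (1, none)
    | .S => (2, none)
    | .sym t => (3, some t)
    | .A t => (4, some t)) ?_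
  rintro (_ | _ | _ | _ | _) (_ | _ | _ | _ | _) h <;> simp_all

abbrev Mem (k : ℕ) : Type :=
  Bool × (Fin k → Bool) × (Fin k → Option (Bool × Bool × Bool × Bool))

abbrev Act (N k : ℕ) : Type := Fin (N + 1) × (Fin k → Bool) × (Fin k → Bool)

inductive Aux (N k : ℕ) : Type
  | start : Aux N k
  | scan (m : Mem k) : Aux N k
  | d1 (m : Mem k) (t : Fin k) (z o : Bool) : Aux N k
  | d2 (m : Mem k) (t : Fin k) (z o r : Bool) : Aux N k
  | d3 (m : Mem k) (t : Fin k) (z o r : Bool) : Aux N k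
  | retS (m : Mem k) : Aux N k
  | retA (a : Act N k) (i : Fin (k + 1)) : Aux N k
  | app (a : Act N k) (t : Fin k) : Aux N k
  | er1 (a : Act N k) (t : Fin k) : Aux N k
  | er2 (a : Act N k) (t : Fin k) : Aux N k

theorem Aux.finite (N k : ℕ) : Finite (Aux N k) := by
  refine Finite.of_injective (β := Fin 10 × Option (Mem k) × Option (Fin k) × Bool × Bool × Bool ×
      Option (Act N k) × Option (Fin (k + 1))) (fun
    | .start => (0, none, none, true, true, true, none, none)
    | .scan m => (1, some m, none, true, true, true, none, none)
    | .d1 m t z o => (2, some m, some t, z, o, true, none, none)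
    | .d2 m t z o r => (3, some m, some t, z, o, r, none, none)
    | .d3 m t z o r => (4, some m, some t, z, o, r, none, none)
    | .retS m => (5, some m, none, true, true, true, none, none)
    | .retA a i => (6, none, none, true, true, true, some a, some i)
    | .app a t => (7, none, some t, true, true, true, some a, none)
    | .er1 a t => (8, none, some t, true, true, true, some a, none)
    | .er2 a t => (9, none, some t, true, true, true, some a, none)) ?_
  intro x y h
  cases x <;> cases y <;> simp only [Prod.mk.injEq, Option.some.injEq] at h <;>
    first
    | (exfalso; revert h; simp; done)
    | (obtain ⟨h0, h1, h2, h3, h4, h5, h6, h7⟩ := h; subst_vars; rfl)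

namespace Sim
variable {M : OTMProgram}

def wF {k : ℕ} (b : Trk k → Bool) : Trk k → Bool
  | .F => true
  | .Z => b .Z
  | .S => b .S
  | .sym t => b (.sym t)
  | .A t => b (.A t)

def wZS {k : ℕ} (b : Trk k → Bool) : Trk k → Bool
  | .F => b .F
  | .Z => true
  | .S => false
  | .sym t => b (.sym t)
  | .A t => b (.A t)

def wS {k : ℕ} (b : Trk k → Bool) : Trk k → Bool
  | .F => b .F
  | .Z => b .Z
  | .S => true
  | .sym t => b (.sym t)
  | .A t => b (.A t)

def wSym {k : ℕ} (b : Trk k → Bool) (u : Fin k) (v : Bool) : Trk k → Bool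
  | .F => b .F
  | .Z => b .Z
  | .S => b .S
  | .sym t => if t = u then v else b (.sym t)
  | .A t => b (.A t)

def wA {k : ℕ} (b : Trk k → Bool) (u : Fin k) (v : Bool) : Trk k → Bool
  | .F => b .F
  | .Z => b .Z
  | .S => b .S
  | .sym t => b (.sym t)
  | .A t => if t = u then v else b (.A t)

/-- symbols read, according to the memory -/
def rd {k : ℕ} (m : Mem k) (t : Fin k) : Bool :=
  match m.2.2 t with
  | none => false
  | some (_, _, o, _) => o

/-- symbols read after the next step, according to the memory -/
def nx {k : ℕ} (m : Mem k) (w mv : Fin k → Bool) (t : Fin k) : Bool :=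
  match m.2.2 t with
  | none => if mv t then false else m.2.1 t
  | some (z, l, _, r) => if mv t then r else if z then w t else l

abbrev Q (M : OTMProgram) : Type := Fin (M.states + 1) × Aux M.states M.tapes

def H (M : OTMProgram) : Q M → Bool
  | (s, .scan m) => m.1 && (match M.trans s (rd m) with
      | none => true
      | some (s', w, mv) => (M.trans s' (nx m w mv)).isNone)
  | _ => false

open scoped Classical in
noncomputable def tr (M : OTMProgram) : Q M → (Trk M.tapes → Bool) →
    Q M × (Trk M.tapes → Bool) × Bool
  | (s, .start), b =>
      ((s, .scan (!(b .S), fun t => b (.sym t),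
        fun _ => if b .F then none else some (true, false, false, false))), wZS b, false)
  | (s, .scan m), b =>
      if b .F then
        if h : ∃ t, m.2.2 t = none ∧ b (.A t) = false then
          ((s, .d1 m h.choose (b .Z) (b (.sym h.choose))), b, true)
        else ((s, .scan m), b, true)
      else match M.trans s (rd m) with
        | none => ((s, .start), b, false)
        | some a => ((s, .retA a 0), wF b, false)
  | (s, .d1 m t z o), b => ((s, .d2 m t z o (b (.sym t))), b, false)
  | (s, .d2 m t z o r), b => ((s, .d3 m t z o r), b, false)
  | (s, .d3 m t z o r), b =>
      ((s, .retS (m.1, m.2.1, Function.update m.2.2 t (some (z, b (.sym t), o, r)))), b, false)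
  | (s, .retS m), b => ((s, if b .Z then .scan m else .retS m), b, false)
  | (s, .retA a i), b =>
      if b .Z then
        if h : i.1 < M.tapes then ((s, .app a ⟨i.1, h⟩), b, false)
        else ((a.1, .start), wS b, false)
      else ((s, .retA a i), b, false)
  | (s, .app a t), b =>
      if b (.A t) then ((s, .app a t), b, true)
      else if a.2.2 t then ((s, .retA a t.succ), wA (wSym b t (a.2.1 t)) t true, false)
      else ((s, .er1 a t), wSym b t (a.2.1 t), false)
  | (s, .er1 a t), b => ((s, .er2 a t), wA b t false, true)
  | (s, .er2 a t), b =>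
      if b (.A t) then ((s, .er2 a t), wA b t false, true)
      else ((s, .retA a t.succ), b, false)

noncomputable def mac (M : OTMProgram) (n : ℕ) (eA : Aux M.states M.tapes ≃ Fin (n + 1))
    (h0 : eA .start = 0) : Mac (Q M) (Trk M.tapes) where
  N := (M.states + 1) * (n + 1) - 1
  eQ := ((Equiv.refl _).prodCongr eA).trans
    (finProdFinEquiv.trans (finCongr (Nat.sub_add_cancel (Nat.mul_pos (Nat.succ_pos _)
      (Nat.succ_pos _))).symm))
  q0 := (0, .start)
  hq0 := by
    apply Fin.ext
    simp only [finCongr_apply, Equiv.trans_apply, Fin.val_cast, Fin.val_zero]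
    simp [h0, finProdFinEquiv]
  tr := tr M
  H := H M
  jf := .F

theorem mac_code (n : ℕ) (eA : Aux M.states M.tapes ≃ Fin (n + 1))
    (h0 : eA .start = 0) (s a) : (((mac M n eA h0).eQ (s, a) : Fin _) : ℕ) =
      (eA a : ℕ) + (n + 1) * (s : ℕ) := by
  rfl

open scoped Classical in
/-- Encoding of a configuration at stage `β`, with the `Z`, `S` tracks given at block `0`. -/
noncomputable def tape (C : OTMConfig M) (β : Ordinal.{0}) (z s : Bool) :
    Ordinal.{0} → Trk M.tapes → Bool
  | x, .F => decide (x < β)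
  | x, .Z => decide (x = 0) && z
  | x, .S => decide (x = 0) && s
  | x, .sym t => C.tape t x
  | x, .A t => decide (x < C.head t)

open scoped Classical in
noncomputable def enc (C : OTMConfig M) (β : Ordinal.{0}) : MCfg (Q M) (Trk M.tapes) :=
  ⟨(C.state, .start), 0, tape C β (decide (0 < β)) (decide (∃ p, β = p + 1))⟩

structure Good (C : OTMConfig M) (β : Ordinal.{0}) : Prop where
  hd : ∀ t, C.head t ≤ β
  tp : ∀ t x, β ≤ x → C.tape t x = false

end Sim

open Ordinal Order

namespace Sim
variable {M : OTMProgram} {n : ℕ} {eA : Aux M.states M.tapes ≃ Fin (n + 1)}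
  {h0 : eA .start = 0}

theorem mac_tr : (mac M n eA h0).tr = tr M := rfl

theorem mac_H : (mac M n eA h0).H = H M := rfl

theorem step_keep {q q' : Q M} {x : Ordinal.{0}} {T : Ordinal.{0} → Trk M.tapes → Bool} {d : Bool}
    (h : tr M q (T x) = (q', T x, d)) :
    (mac M n eA h0).step ⟨q, x, T⟩ = ⟨q', if d then x + 1 else leftOf x, T⟩ := by
  have h' : (mac M n eA h0).tr q (T x) = (q', T x, d) := h
  apply MCfg.ext'
  · simp [Mac.step, h']
  · simp [Mac.step, h']
  · intro y j
    simp only [Mac.step, h']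
    split_ifs with hy
    · rw [hy]
    · rfl

theorem step_write {q q' : Q M} {x x' : Ordinal.{0}} {T T' : Ordinal.{0} → Trk M.tapes → Bool}
    {b : Trk M.tapes → Bool} {d : Bool}
    (h : tr M q (T x) = (q', b, d)) (hd : (if d then x + 1 else leftOf x) = x')
    (h1 : ∀ j, T' x j = b j)
    (h2 : ∀ y, y ≠ x → ∀ j, T' y j = T y j) :
    (mac M n eA h0).step ⟨q, x, T⟩ = ⟨q', x', T'⟩ := by
  have h' : (mac M n eA h0).tr q (T x) = (q', b, d) := h
  apply MCfg.ext'
  · simp [Mac.step, h']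
  · simp [Mac.step, h', hd]
  · intro y j
    simp only [Mac.step, h']
    split_ifs with hy
    · rw [hy, h1]
    · rw [h2 y hy]

/-- the true information on the neighbourhood of head `t` -/
noncomputable def val (C : OTMConfig M) (t : Fin M.tapes) : Bool × Bool × Bool × Bool :=
  open scoped Classical in
  (decide (C.head t = 0), C.tape t (leftOf (C.head t)), C.tape t (C.head t),
    C.tape t (C.head t + 1))

structure OK (C : OTMConfig M) (β : Ordinal.{0}) (m : Mem M.tapes) : Prop where
  c0 : ∀ t, m.2.1 t = C.tape t 0
  info : ∀ t, m.2.2 t = none ∨ m.2.2 t = some (val C t)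
  nz : β = 0 → ∀ t, m.2.2 t ≠ none

/-- invariant of the first pass -/
def I1 (n : ℕ) (eA : Aux M.states M.tapes ≃ Fin (n + 1)) (h0 : eA .start = 0)
    (s : Fin (M.states + 1)) (T : Ordinal.{0} → Trk M.tapes → Bool)
    (c : MCfg (Q M) (Trk M.tapes)) : Prop :=
  c.st.1 = s ∧ ¬ (mac M n eA h0).halting c ∧ c.tp = T

theorem pass1_one {C : OTMConfig M} {β μ : Ordinal.{0}} {m : Mem M.tapes} (hok : OK C β m)
    (hμ : ∀ t, C.head t < β → C.head t ≤ μ)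
    (hex : ∃ t, m.2.2 t = none ∧ C.head t < β) :
    ∃ t, m.2.2 t = none ∧ C.head t < β ∧ ∃ δ ≤ (μ + 5) * 2,
      (mac M n eA h0).Reach (I1 n eA h0 C.state (tape C β true false))
        ⟨(C.state, .scan m), 0, tape C β true false⟩ δ
        ⟨(C.state, .scan (m.1, m.2.1, Function.update m.2.2 t (some (val C t)))), 0,
          tape C β true false⟩ := by
  classical
  set T := tape C β true false with hT
  -- the minimal position
  obtain ⟨t0, ht0, hmin⟩ := WellFounded.has_min (r := ((· < ·) : Ordinal.{0} → Ordinal.{0} → Prop))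
    wellFounded_lt {x | ∃ t, m.2.2 t = none ∧ C.head t < β ∧ C.head t = x}
    (by obtain ⟨t, h1, h2⟩ := hex; exact ⟨_, t, h1, h2, rfl⟩)
  obtain ⟨t1, ht1, hlt1, rfl⟩ := ht0
  set x := C.head t1 with hx
  have hmin' : ∀ t, m.2.2 t = none → C.head t ≤ x → C.head t = x := by
    intro t h1 h2
    by_contra h3
    exact hmin (C.head t) ⟨t, h1, h2.trans_lt hlt1, rfl⟩ (lt_of_le_of_ne h2 h3)
  have hFx : ∀ y, y < β → T y .F = true := by intro y hy; simp [hT, tape, hy]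
  have hAx : ∀ y t, T y (.A t) = false ↔ C.head t ≤ y := by
    intro y t; simp [hT, tape]
  have hI : ∀ a y, (∀ m', a ≠ Aux.scan m') → I1 n eA h0 C.state T ⟨(C.state, a), y, T⟩ := by
    intro a y ha
    refine ⟨rfl, ?_, rfl⟩
    rintro ⟨h1, -⟩
    cases a
    case scan m' => exact ha m' rfl
    all_goals exact absurd h1 (by simp [mac, H])
  have hIs : ∀ m' y, y < β → I1 n eA h0 C.state T ⟨(C.state, .scan m'), y, T⟩ := by
    intro m' y hy
    refine ⟨rfl, ?_, rfl⟩
    rintro ⟨-, h2⟩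
    have := hFx y hy
    exact absurd (h2.symm.trans this) (by simp)
  have R1 : (mac M n eA h0).Reach (I1 n eA h0 C.state T) ⟨(C.state, .scan m), 0, T⟩ x
      ⟨(C.state, .scan m), x, T⟩ := by
    apply Mac.Reach.scan_const
    · intro y hy; exact hIs _ _ (hy.trans hlt1)
    · intro y hy
      rw [mac_tr]
      simp only [tr, hFx y (hy.trans hlt1), if_true]
      rw [dif_neg]
      rintro ⟨t, h1, h2⟩
      rw [hAx] at h2
      exact absurd (hmin' t h1 (h2.trans hy.le)) (h2.trans_lt hy).ne
  have hexx : ∃ t, m.2.2 t = none ∧ T x (.A t) = false := ⟨t1, ht1, (hAx _ _).2 le_rfl⟩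
  set t := hexx.choose with ht
  obtain ⟨hn, hA⟩ := hexx.choose_spec
  rw [← ht] at hn hA
  have hht : C.head t = x := hmin' t hn ((hAx _ _).1 hA)
  refine ⟨t, hn, hht ▸ hlt1, ?_⟩
  have R2 : (mac M n eA h0).Reach (I1 n eA h0 C.state T) ⟨(C.state, .scan m), x, T⟩ 1
      ⟨(C.state, .d1 m t (T x .Z) (T x (.sym t))), x + 1, T⟩ := by
    apply Mac.Reach.step (hIs _ _ hlt1)
    apply step_keep (d := true)
    simp only [tr, hFx x hlt1, if_true]
    rw [dif_pos hexx]
  have R3 : (mac M n eA h0).Reach (I1 n eA h0 C.state T)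
      ⟨(C.state, .d1 m t (T x .Z) (T x (.sym t))), x + 1, T⟩ 1
      ⟨(C.state, .d2 m t (T x .Z) (T x (.sym t)) (T (x + 1) (.sym t))), x, T⟩ := by
    apply Mac.Reach.step (hI _ _ (by simp))
    rw [step_keep (d := false) rfl]
    simp [leftOf_add_one]
  have R4 : (mac M n eA h0).Reach (I1 n eA h0 C.state T)
      ⟨(C.state, .d2 m t (T x .Z) (T x (.sym t)) (T (x + 1) (.sym t))), x, T⟩ 1
      ⟨(C.state, .d3 m t (T x .Z) (T x (.sym t)) (T (x + 1) (.sym t))), leftOf x, T⟩ := by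
    apply Mac.Reach.step (hI _ _ (by simp))
    rw [step_keep (d := false) rfl]
    simp
  have R5 : (mac M n eA h0).Reach (I1 n eA h0 C.state T)
      ⟨(C.state, .d3 m t (T x .Z) (T x (.sym t)) (T (x + 1) (.sym t))), leftOf x, T⟩ 1
      ⟨(C.state, .retS (m.1, m.2.1, Function.update m.2.2 t (some (val C t)))),
        leftOf (leftOf x), T⟩ := by
    apply Mac.Reach.step (hI _ _ (by simp))
    rw [step_keep (d := false) rfl]
    have : val C t = (T x .Z, T (leftOf x) (.sym t), T x (.sym t), T (x + 1) (.sym t)) := by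
      simp [val, hT, tape, hht]
    rw [this]
    simp
  obtain ⟨l, hl, R6⟩ := Mac.Reach.ret (m := mac M n eA h0) (I := I1 n eA h0 C.state T)
    (q := (C.state, .retS (m.1, m.2.1, Function.update m.2.2 t (some (val C t))))) (T := T)
    (fun y => hI _ _ (by simp))
    (fun y hy => by
      rw [mac_tr]
      have : T y .Z = false := by simp [hT, tape, hy]
      simp [tr, this]) (leftOf (leftOf x))
  have R7 : (mac M n eA h0).Reach (I1 n eA h0 C.state T)
      ⟨(C.state, .retS (m.1, m.2.1, Function.update m.2.2 t (some (val C t)))), 0, T⟩ 1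
      ⟨(C.state, .scan (m.1, m.2.1, Function.update m.2.2 t (some (val C t)))), 0, T⟩ := by
    apply Mac.Reach.step (hI _ _ (by simp))
    rw [step_keep (d := false) rfl]
    have : T 0 .Z = true := by simp [hT, tape]
    simp [this, leftOf_zero]
  refine ⟨_, ?_, R1.trans (R2.trans (R3.trans (R4.trans (R5.trans (R6.trans R7)))))⟩
  have hxμ : x ≤ μ := hμ _ hlt1
  have hl' : (l : Ordinal.{0}) ≤ μ := hl.trans ((leftOf_le _).trans ((leftOf_le _).trans hxμ))
  have e1 : x + (1 + (1 + (1 + (1 + ((l : Ordinal.{0}) + 1))))) = x + ((l + 5 : ℕ) : Ordinal.{0}) := by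
    congr 1
    norm_cast
    omega
  rw [e1, show ((2 : Ordinal.{0})) = 1 + 1 from one_add_one_eq_two.symm, mul_add, mul_one]
  apply add_le_add
  · exact hxμ.trans le_self_add
  · push_cast
    gcongr

theorem pass1 {C : OTMConfig M} {β μ : Ordinal.{0}}
    (hβ : ∀ t, C.head t ≤ β)
    (hμ : ∀ t, C.head t < β → C.head t ≤ μ) (N : ℕ) :
    ∀ m : Mem M.tapes, OK C β m →
    (open scoped Classical in
      (Finset.univ.filter (fun t => m.2.2 t = none ∧ C.head t < β)).card = N) →
    ∃ m', OK C β m' ∧ m'.1 = m.1 ∧ (∀ t, m'.2.2 t = none → C.head t = β) ∧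
      ∃ δ ≤ (μ + 5) * (2 * N : ℕ),
      (mac M n eA h0).Reach (I1 n eA h0 C.state (tape C β true false))
        ⟨(C.state, .scan m), 0, tape C β true false⟩ δ
        ⟨(C.state, .scan m'), 0, tape C β true false⟩ := by
  classical
  induction N with
  | zero =>
    intro m hok hc
    refine ⟨m, hok, rfl, ?_, 0, by simp, Mac.Reach.refl _⟩
    intro t ht
    by_contra hne
    rw [Finset.card_eq_zero, Finset.filter_eq_empty_iff] at hc
    exact hc (Finset.mem_univ t) ⟨ht, lt_of_le_of_ne (hβ t) hne⟩
  | succ N ih =>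
    intro m hok hc
    have hex : ∃ t, m.2.2 t = none ∧ C.head t < β := by
      have : 0 < (Finset.univ.filter (fun t => m.2.2 t = none ∧ C.head t < β)).card := by
        convert Nat.succ_pos N
      obtain ⟨t, ht⟩ := Finset.card_pos.1 this
      exact ⟨t, (Finset.mem_filter.1 ht).2⟩
    obtain ⟨t, h1, h2, δ, hδ, R⟩ := pass1_one (n := n) (eA := eA) (h0 := h0) hok hμ hex
    obtain ⟨m', g1, g2, g3, δ', hδ', R'⟩ := ih
      (m.1, m.2.1, Function.update m.2.2 t (some (val C t)))
      ⟨hok.c0, fun u => by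
        by_cases hu : u = t
        · subst hu; right; simp
        · simpa [Function.update_of_ne hu] using hok.info u,
       fun hb u => by
        by_cases hu : u = t
        · subst hu; simp
        · simpa [Function.update_of_ne hu] using hok.nz hb u⟩
      (by
        have : (Finset.univ.filter (fun u => (Function.update m.2.2 t (some (val C t))) u = none ∧
            C.head u < β)) = (Finset.univ.filter (fun u => m.2.2 u = none ∧ C.head u < β)).erase t := by
          ext u
          by_cases hu : u = t
          · subst hu; simp
          · simp [Function.update_of_ne hu, hu]
        have h3 : t ∈ Finset.univ.filter (fun u => m.2.2 u = none ∧ C.head u < β) := by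
          simp [h1, h2]
        have h4 := Finset.card_erase_of_mem h3
        rw [← this] at h4
        have hc' : (Finset.univ.filter (fun u => m.2.2 u = none ∧ C.head u < β)).card = N + 1 := by
          convert hc
        rw [hc'] at h4
        convert h4 using 1; rfl)
    refine ⟨m', g1, g2, g3, _, ?_, R.trans R'⟩
    calc δ + δ' ≤ (μ + 5) * 2 + (μ + 5) * (2 * N : ℕ) := add_le_add hδ hδ'
      _ = (μ + 5) * ((2 : ℕ) + (2 * N : ℕ)) := by rw [mul_add]; rfl
      _ = _ := by congr 1; norm_cast; omega

end Sim

open Ordinal Order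

namespace Sim
variable {M : OTMProgram} {n : ℕ} {eA : Aux M.states M.tapes ≃ Fin (n + 1)}
  {h0 : eA .start = 0}

theorem rd_eq {C : OTMConfig M} {β : Ordinal.{0}} {m : Mem M.tapes} (hg : Good C β)
    (hok : OK C β m) (hc : ∀ t, m.2.2 t = none → C.head t = β) : rd m = M.readSymbols C := by
  funext t
  unfold rd OTMProgram.readSymbols
  rcases hok.info t with h | h
  · rw [h, hc t h]
    exact (hg.tp t β le_rfl).symm
  · rw [h]
    rfl

theorem nx_eq {C : OTMConfig M} {β : Ordinal.{0}} {m : Mem M.tapes} (hg : Good C β)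
    (hok : OK C β m) (hc : ∀ t, m.2.2 t = none → C.head t = β) (hl : ¬ ∃ p, β = p + 1)
    {s' w mv} (htr : M.trans C.state (M.readSymbols C) = some (s', w, mv)) :
    nx m w mv = M.readSymbols (M.stepConfig C) := by
  funext t
  unfold nx OTMProgram.readSymbols OTMProgram.stepConfig
  rw [htr]
  rcases hok.info t with h | h
  · have hb : β ≠ 0 := fun hb => hok.nz hb t h
    have hlim : IsSuccLimit β := by
      rcases ord_cases β with h1 | h1 | h1
      · exact absurd h1 hb
      · exact absurd h1 hl
      · exact h1
    simp only [h, hc t h]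
    cases mv t
    · simp [leftOf_limit hlim, hb.symm, hok.c0]
    · have : β + 1 ≠ β := (lt_add_one β).ne'
      simp [this, hg.tp t (β + 1) (lt_add_one β).le]
  · simp only [h, val]
    cases mv t
    · simp [leftOf_eq_self]
    · have : C.head t + 1 ≠ C.head t := (lt_add_one _).ne'
      simp [this]

theorem H_iff {C : OTMConfig M} {β : Ordinal.{0}} {m : Mem M.tapes} (hg : Good C β)
    (hok : OK C β m) (hc : ∀ t, m.2.2 t = none → C.head t = β)
    (hl : m.1 = true → ¬ ∃ p, β = p + 1) :
    H M (C.state, .scan m) = true ↔ m.1 = true ∧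
      M.trans (M.stepConfig C).state (M.readSymbols (M.stepConfig C)) = none := by
  simp only [H, Bool.and_eq_true, rd_eq hg hok hc]
  refine and_congr_right fun hm => ?_
  cases htr : M.trans C.state (M.readSymbols C) with
  | none =>
    have : M.stepConfig C = C := by unfold OTMProgram.stepConfig; rw [htr]
    simp [this, htr]
  | some a =>
    obtain ⟨s', w, mv⟩ := a
    have h1 : (M.stepConfig C).state = s' := by unfold OTMProgram.stepConfig; rw [htr]
    simp only [nx_eq hg hok hc (hl hm) htr, h1, Option.isNone_iff_eq_none]

def I2 (n : ℕ) (eA : Aux M.states M.tapes ≃ Fin (n + 1)) (h0 : eA .start = 0)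
    (C : OTMConfig M) (β : Ordinal.{0})
    (c : MCfg (Q M) (Trk M.tapes)) : Prop :=
  c.st.1 = C.state ∧ ¬ (mac M n eA h0).halting c ∧
    (c.tp = (enc C β).tp ∨ c.tp = tape C β true false)

theorem start_step (C : OTMConfig M) (β : Ordinal.{0}) :
    (mac M n eA h0).step (enc C β) = ⟨(C.state, .scan (!((enc C β).tp 0 .S),
      fun t => C.tape t 0,
      fun _ => if (enc C β).tp 0 .F then none else some (true, false, false, false))), 0,
        tape C β true false⟩ := by
  unfold enc
  refine step_write (b := wZS ((enc C β).tp 0)) (d := false) rfl (by simp [leftOf_zero]) ?_ ?_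
  · intro j
    cases j <;> simp [tape, wZS, enc]
  · intro y hy j
    cases j <;> simp [tape, hy]

theorem front {C : OTMConfig M} {β μ : Ordinal.{0}} (hg : Good C β)
    (hμ : ∀ t, C.head t < β → C.head t ≤ μ) :
    ∃ m, OK C β m ∧ (m.1 = true ↔ ¬ ∃ p, β = p + 1) ∧ (∀ t, m.2.2 t = none → C.head t = β) ∧
      (∃ δ ≤ (μ + 5) * (2 * M.tapes + 1 : ℕ),
      (mac M n eA h0).Reach (I2 n eA h0 C β) (enc C β) δ
        ⟨(C.state, .scan m), 0, tape C β true false⟩) ∧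
      (mac M n eA h0).Reach (I2 n eA h0 C β) ⟨(C.state, .scan m), 0, tape C β true false⟩ β
        ⟨(C.state, .scan m), β, tape C β true false⟩ := by
  classical
  have R0 : (mac M n eA h0).Reach (I2 n eA h0 C β) (enc C β) 1 _ :=
    Mac.Reach.step ⟨rfl, by rintro ⟨h1, -⟩; exact absurd h1 (by simp [mac, H, enc]), Or.inl rfl⟩
      (start_step C β)
  obtain ⟨m, g1, g2, g3, δ, hδ, R1⟩ := pass1 (n := n) (eA := eA) (h0 := h0) hg.hd hμ _
    (!((enc C β).tp 0 .S), fun t => C.tape t 0,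
      fun _ => if (enc C β).tp 0 .F then none else some (true, false, false, false))
    (by
      refine ⟨fun t => rfl, fun t => ?_, fun hb t => ?_⟩
      · by_cases hb : β = 0
        · right
          subst hb
          have h1 : C.head t = 0 := le_antisymm (hg.hd t) zero_le
          simp [enc, tape, val, h1, leftOf_zero, hg.tp t _ zero_le]
        · left
          have : 0 < β := pos_iff_ne_zero.2 hb
          simp [enc, tape, this]
      · subst hb
        simp [enc, tape]) rfl
  refine ⟨m, g1, ?_, g3, ⟨_, ?_, R0.trans (R1.mono ?_)⟩, ?_⟩
  · rw [g2]
    simp [enc, tape]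
  · have h1 : δ ≤ (μ + 5) * (2 * M.tapes : ℕ) := by
      refine hδ.trans (mul_le_mul_right ?_ _)
      have : (Finset.univ.filter (fun t => (if (enc C β).tp 0 .F = true then none else some (true, false, false, false)) = none ∧ C.head t < β)).card ≤ M.tapes := by
        simpa using Finset.card_filter_le (Finset.univ : Finset (Fin M.tapes)) _
      exact_mod_cast Nat.mul_le_mul_left 2 this
    have h2 : (1 : Ordinal.{0}) ≤ μ + 5 := by
      calc (1 : Ordinal.{0}) ≤ 5 := by norm_num
        _ ≤ μ + 5 := le_add_self
    calc 1 + δ ≤ (μ + 5) * 1 + (μ + 5) * (2 * M.tapes : ℕ) := by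
          rw [mul_one]; exact add_le_add h2 h1
      _ = (μ + 5) * (1 + (2 * M.tapes : ℕ)) := by rw [mul_add]
      _ = _ := by congr 1; norm_cast; omega
  · rintro d ⟨h1, h2, h3⟩
    exact ⟨h1, h2, Or.inr h3⟩
  · apply Mac.Reach.scan_const
    · intro y hy
      refine ⟨rfl, ?_, Or.inr rfl⟩
      rintro ⟨-, h⟩
      have h' : decide (y < β) = false := h
      simp [hy] at h'
    · intro y hy
      have hF : tape C β true false y .F = true := by simp [tape, hy]
      rw [mac_tr]
      simp only [tr, hF, if_true]
      rw [dif_neg]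
      rintro ⟨t, h1, h2⟩
      simp only [tape, decide_eq_false_iff_not, not_lt] at h2
      rw [g3 t h1] at h2
      exact absurd hy (not_lt.2 h2)

end Sim

open Ordinal Order

theorem add_bound {v a b : Ordinal.{0}} {p q : ℕ} (h1 : a ≤ v * (p : ℕ)) (h2 : b ≤ v * (q : ℕ)) :
    a + b ≤ v * ((p + q : ℕ) : Ordinal.{0}) := by
  push_cast
  rw [mul_add]
  exact add_le_add h1 h2

theorem one_bound {v a : Ordinal.{0}} (h1 : a ≤ v) : a ≤ v * ((1 : ℕ) : Ordinal.{0}) := by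
  simpa using h1

namespace Sim
variable {M : OTMProgram} {n : ℕ} {eA : Aux M.states M.tapes ≃ Fin (n + 1)}
  {h0 : eA .start = 0}

theorem app_one {D D' : OTMConfig M} {γ β : Ordinal.{0}} {t : Fin M.tapes}
    {a : Act M.states M.tapes} {s : Fin (M.states + 1)}
    (hh : D'.head t = if a.2.2 t then D.head t + 1 else leftOf (D.head t))
    (ht : ∀ x, D'.tape t x = if x = D.head t then a.2.1 t else D.tape t x)
    (hh' : ∀ u, u ≠ t → D'.head u = D.head u)
    (ht' : ∀ u, u ≠ t → ∀ x, D'.tape u x = D.tape u x)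
    (hβ : D.head t ≤ β)
    {I : MCfg (Q M) (Trk M.tapes) → Prop}
    (hI : ∀ q x T, (∀ m, q ≠ Aux.scan m) →
      (∀ y j, T y j = tape D γ true false y j ∨ T y j = tape D' γ true false y j) →
      I ⟨(s, q), x, T⟩) {x : Ordinal.{0}} (hx : x ≤ β) :
    ∃ x' ≤ β, ∃ δ ≤ (β + 5) * (7 : ℕ), (mac M n eA h0).Reach I
      ⟨(s, .retA a t.castSucc), x, tape D γ true false⟩ δ
      ⟨(s, .retA a t.succ), x', tape D' γ true false⟩ := by
  classical
  set T := tape D γ true false with hT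
  set T' := tape D' γ true false with hT'
  set h := D.head t with hhd
  have hv1 : (1 : Ordinal.{0}) ≤ β + 5 := by
    calc (1 : Ordinal.{0}) ≤ 5 := by norm_num
      _ ≤ β + 5 := le_add_self
  have hvβ : ∀ {z}, z ≤ β → z ≤ β + 5 := fun hz => hz.trans le_self_add
  obtain ⟨l, hl, R1⟩ := Mac.Reach.ret (m := mac M n eA h0) (I := I)
    (q := (s, .retA a t.castSucc)) (T := T)
    (fun y => hI _ _ _ (by simp) (fun _ _ => Or.inl rfl))
    (fun y hy => by
      rw [mac_tr]
      have : T y .Z = false := by simp [hT, tape, hy]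
      simp [tr, this]) x
  have R2 : (mac M n eA h0).Reach I ⟨(s, .retA a t.castSucc), 0, T⟩ 1 ⟨(s, .app a t), 0, T⟩ := by
    apply Mac.Reach.step (hI _ _ _ (by simp) (fun _ _ => Or.inl rfl))
    have hZ : T 0 .Z = true := by simp [hT, tape]
    rw [step_keep (d := false) (q' := (s, .app a t))]
    · simp [leftOf_zero]
    · simp [tr, hZ]
  have R3 : (mac M n eA h0).Reach I ⟨(s, .app a t), 0, T⟩ h ⟨(s, .app a t), h, T⟩ := by
    apply Mac.Reach.scan_const
    · intro y hy; exact hI _ _ _ (by simp) (fun _ _ => Or.inl rfl)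
    · intro y hy
      rw [mac_tr]
      have : T y (.A t) = true := by simp [hT, tape, ← hhd, hy]
      simp [tr, this]
  have hAh : T h (.A t) = false := by simp [hT, tape, ← hhd]
  have R123 := R1.trans (R2.trans R3)
  have B123 : (l : Ordinal.{0}) + (1 + h) ≤ (β + 5) * ((1 + (1 + 1) : ℕ) : Ordinal.{0}) :=
    add_bound (one_bound (hvβ (hl.trans hx))) (add_bound (one_bound hv1) (one_bound (hvβ hβ)))
  by_cases hmv : a.2.2 t = true
  · have R4 : (mac M n eA h0).Reach I ⟨(s, .app a t), h, T⟩ 1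
        ⟨(s, .retA a t.succ), leftOf h, T'⟩ := by
      apply Mac.Reach.step (hI _ _ _ (by simp) (fun _ _ => Or.inl rfl))
      apply step_write (d := false) (b := wA (wSym (T h) t (a.2.1 t)) t true)
      · simp [tr, hAh, hmv]
      · simp
      · intro j
        cases j with
        | F => rfl
        | Z => rfl
        | S => rfl
        | sym u =>
          by_cases hu : u = t
          · subst hu; simp [wA, wSym, hT', tape, ht]
          · simp [wA, wSym, hT', hT, tape, ht' u hu, hu]
        | A u =>
          by_cases hu : u = t
          · subst hu; simp [wA, hT', tape, hh, hmv]
          · simp [wA, wSym, hT', hT, tape, hh' u hu, hu]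
      · intro y hy j
        cases j with
        | F => rfl
        | Z => rfl
        | S => rfl
        | sym u =>
          by_cases hu : u = t
          · subst hu; simp [hT', hT, tape, ht, hy]
          · simp [hT', hT, tape, ht' u hu]
        | A u =>
          by_cases hu : u = t
          · subst hu
            simp only [hT', hT, tape, hh, hmv, if_true]
            rw [← hhd]
            congr 1
            simp only [lt_add_one_iff, eq_iff_iff]
            exact ⟨fun h => lt_of_le_of_ne h hy, le_of_lt⟩
          · simp [hT', hT, tape, hh' u hu]
    refine ⟨leftOf h, (leftOf_le _).trans hβ, _, ?_, R123.trans R4⟩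
    refine (add_bound B123 (one_bound hv1)).trans (mul_le_mul_right ?_ _)
    norm_num
  · have hmv' : a.2.2 t = false := by simpa using hmv
    set y := leftOf h with hy
    have hyh : y ≤ h := leftOf_le h
    let W : Ordinal.{0} → Ordinal.{0} → Trk M.tapes → Bool := fun c z =>
      wA (wSym (T z) t (D'.tape t z)) t (decide (z < h ∧ ¬ (y ≤ z ∧ z < c)))
    have hWI : ∀ q x c, (∀ m, q ≠ Aux.scan m) → I ⟨(s, q), x, W c⟩ := by
      intro q x c hq
      apply hI _ _ _ hq
      intro z j
      cases j with
      | F => exact Or.inl rfl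
      | Z => exact Or.inl rfl
      | S => exact Or.inl rfl
      | sym u =>
        right
        by_cases hu : u = t
        · subst hu; simp [W, wA, wSym, hT', tape]
        · simp [W, wA, wSym, hT', hT, tape, ht' u hu, hu]
      | A u =>
        by_cases hu : u = t
        · subst hu
          simp only [W, wA, if_true, hT', hT, tape, hh, hmv', ← hhd, ← hy]
          by_cases h1 : y ≤ z ∧ z < c
          · right
            simp [h1]
          · left
            simp [h1]
        · left
          simp [W, wA, wSym, hT, tape, hu]
    have R4 : (mac M n eA h0).Reach I ⟨(s, .app a t), h, T⟩ 1 ⟨(s, .er1 a t), y, W y⟩ := by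
      apply Mac.Reach.step (hI _ _ _ (by simp) (fun _ _ => Or.inl rfl))
      have hneg : ∀ z, ¬ (y ≤ z ∧ z < y) := fun z hz => absurd hz.1 (not_le.2 hz.2)
      apply step_write (d := false) (b := wSym (T h) t (a.2.1 t))
      · simp [tr, hAh, hmv']
      · simp [← hy]
      · intro j
        cases j with
        | F => rfl
        | Z => rfl
        | S => rfl
        | sym u =>
          by_cases hu : u = t
          · subst hu; simp [W, wA, wSym, ht]
          · simp [W, wA, wSym, hu]
        | A u =>
          by_cases hu : u = t
          · subst hu; simp [W, wA, wSym, hAh]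
          · simp [W, wA, wSym, hu]
      · intro z hz j
        cases j with
        | F => rfl
        | Z => rfl
        | S => rfl
        | sym u =>
          by_cases hu : u = t
          · subst hu; simp [W, wA, wSym, hT, tape, ht, hz]
          · simp [W, wA, wSym, hu]
        | A u =>
          by_cases hu : u = t
          · subst hu
            simp only [W, wA, if_true, hT, tape, hneg, ← hhd]
            simp
          · simp [W, wA, wSym, hu]
    have hWstep : ∀ c, y ≤ c → ∀ j, W (c + 1) c j = wA (W c c) t false j := by
      intro c hc j
      cases j with
      | F => rfl
      | Z => rfl
      | S => rfl
      | sym u => rfl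
      | A u =>
        by_cases hu : u = t
        · subst hu; simp [W, wA, hc]
        · simp [W, wA, hu]
    have hWoff : ∀ c z, z ≠ c → ∀ j, W (c + 1) z j = W c z j := by
      intro c z hz j
      cases j with
      | F => rfl
      | Z => rfl
      | S => rfl
      | sym u => rfl
      | A u =>
        by_cases hu : u = t
        · subst hu
          have : z < c + 1 ↔ z < c := by
            rw [lt_add_one_iff]
            exact ⟨fun h => lt_of_le_of_ne h hz, le_of_lt⟩
          simp only [W, wA, this]
        · simp [W, wA, hu]
    have R5 : (mac M n eA h0).Reach I ⟨(s, .er1 a t), y, W y⟩ 1 ⟨(s, .er2 a t), y + 1, W (y + 1)⟩ := by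
      apply Mac.Reach.step (hWI _ _ _ (by simp))
      exact step_write (d := true) rfl rfl (hWstep y le_rfl) (hWoff y)
    obtain ⟨X, hX, hXe⟩ : ∃ X ≤ h, y + 1 + X = max (y + 1) h := by
      rcases le_total h (y + 1) with h1 | h1
      · exact ⟨0, zero_le, by rw [add_zero, max_eq_left h1]⟩
      · obtain ⟨X, hX⟩ := exists_add_of_le h1
        exact ⟨X, by rw [hX]; exact le_add_self, by rw [← hX, max_eq_right h1]⟩
    have hlt : ∀ x < X, y + 1 + x < h := by
      intro x hx
      have h1 : y + 1 + x < y + 1 + X := (add_lt_add_iff_left _).2 hx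
      rw [hXe] at h1
      rcases lt_max_iff.1 h1 with h2 | h2
      · exact absurd h2 (not_lt.2 le_self_add)
      · exact h2
    have hyle : ∀ x, y ≤ y + 1 + x := fun x => by rw [add_assoc]; exact le_self_add
    have R6 : (mac M n eA h0).Reach I ⟨(s, .er2 a t), y + 1, W (y + 1)⟩ X
        ⟨(s, .er2 a t), y + 1 + X, W (y + 1 + X)⟩ := by
      have := Mac.Reach.scan (m := mac M n eA h0) (I := I) (q := (s, .er2 a t)) (a := y + 1)
        (T := fun x => W (y + 1 + x)) X (fun x _ => hWI _ _ _ (by simp))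
        (fun x hx => by
          refine step_write (d := true) (b := wA (W (y + 1 + x) (y + 1 + x)) t false) ?_ rfl ?_ ?_
          · have : W (y + 1 + x) (y + 1 + x) (.A t) = true := by
              simp [W, wA, hlt x hx]
            simp only [tr, this, if_true]
          · rw [← add_assoc]; exact hWstep _ (hyle x)
          · rw [← add_assoc]; exact hWoff _)
        (fun x _ hx z j => by
          by_cases hz : z < y + 1 + x
          · obtain ⟨g, hg, hzg⟩ := (lt_add_iff_of_isSuccLimit hx).1 hz
            refine ⟨g, hg, fun i h1 _ => ?_⟩
            have hz' : z < y + 1 + i := hzg.trans_le ((add_le_add_iff_left _).2 h1)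
            simp only [W, hz, hz']
          · refine ⟨0, hx.bot_lt, fun i _ h2 => ?_⟩
            have hz' : ¬ z < y + 1 + i := fun h3 =>
              hz (h3.trans ((add_lt_add_iff_left _).2 h2))
            simp only [W, hz, hz'])
      simpa using this
    have hfin : W (y + 1 + X) = T' := by
      funext z j
      cases j with
      | F => rfl
      | Z => rfl
      | S => rfl
      | sym u =>
        by_cases hu : u = t
        · subst hu; simp [W, wA, wSym, hT', tape]
        · simp [W, wA, wSym, hT', hT, tape, ht' u hu, hu]
      | A u =>
        by_cases hu : u = t
        · subst hu
          simp only [W, wA, if_true, hT', tape, hh, hmv', ← hhd, ← hy]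
          rw [hXe]
          simp only [Bool.false_eq_true, if_false]
          congr 1
          simp only [eq_iff_iff]
          constructor
          · rintro ⟨h1, h2⟩
            by_contra h3
            exact h2 ⟨not_lt.1 h3, h1.trans_le (le_max_right _ _)⟩
          · intro h1
            exact ⟨h1.trans_le hyh, fun h2 => absurd h1 (not_lt.2 h2.1)⟩
        · simp [W, wA, wSym, hT', hT, tape, hh' u hu, hu]
    rw [hfin] at R6
    have R7 : (mac M n eA h0).Reach I ⟨(s, .er2 a t), y + 1 + X, T'⟩ 1
        ⟨(s, .retA a t.succ), leftOf (y + 1 + X), T'⟩ := by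
      apply Mac.Reach.step (hI _ _ _ (by simp) (fun _ _ => Or.inr rfl))
      rw [step_keep (d := false) (q' := (s, .retA a t.succ))]
      · simp
      · have : T' (y + 1 + X) (.A t) = false := by
          simp only [hT', tape, hh, hmv', ← hhd, ← hy, Bool.false_eq_true, if_false]
          simpa using hyle X
        simp [tr, this]
    refine ⟨leftOf (y + 1 + X), ?_, _, ?_, R123.trans (R4.trans (R5.trans (R6.trans R7)))⟩
    · rw [hXe]
      rcases max_choice (y + 1) h with h1 | h1
      · rw [h1, leftOf_add_one]; exact hyh.trans hβ
      · rw [h1]; exact hyh.trans hβ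
    · exact (add_bound B123 (add_bound (one_bound hv1) (add_bound (one_bound hv1)
        (add_bound (one_bound (hvβ (hX.trans hβ))) (one_bound hv1)))))

end Sim

open Ordinal Order

namespace Sim
variable {M : OTMProgram} {n : ℕ} {eA : Aux M.states M.tapes ≃ Fin (n + 1)}
  {h0 : eA .start = 0}

/-- the invariant during a stage -/
def IS (n : ℕ) (eA : Aux M.states M.tapes ≃ Fin (n + 1)) (h0 : eA .start = 0)
    (C : OTMConfig M) (β : Ordinal.{0})
    (c : MCfg (Q M) (Trk M.tapes)) : Prop :=
  c.st.1 = C.state ∧ ¬ (mac M n eA h0).halting c ∧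
    ∀ x j, (x = 0 ∧ j = .S) ∨ c.tp x j = (enc C β).tp x j ∨
      c.tp x j = (enc (M.stepConfig C) (β + 1)).tp x j

noncomputable def mix (C C' : OTMConfig M) (i : ℕ) : OTMConfig M where
  state := C.state
  head := fun t => if t.1 < i then C'.head t else C.head t
  tape := fun t => if t.1 < i then C'.tape t else C.tape t

theorem stage {C : OTMConfig M} {β : Ordinal.{0}} (hg : Good C β)
    {a : Act M.states M.tapes}
    (htr : M.trans C.state (M.readSymbols C) = some a)
    (hn : M.trans (M.stepConfig C).state (M.readSymbols (M.stepConfig C)) ≠ none) :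
    ∃ δ, 0 < δ ∧ δ ≤ (β + 5) * ((9 * M.tapes + 5 : ℕ) : Ordinal.{0}) ∧
      (mac M n eA h0).Reach (IS n eA h0 C β) (enc C β) δ (enc (M.stepConfig C) (β + 1)) := by
  classical
  obtain ⟨s', w, mv⟩ := a
  set C' := M.stepConfig C with hC'
  have hC'eq : C' = { state := s'
                      head := fun t => if mv t then C.head t + 1 else leftOf (C.head t)
                      tape := fun t i => if i = C.head t then w t else C.tape t i } := by
    rw [hC']; unfold OTMProgram.stepConfig; rw [htr]
  have hv1 : (1 : Ordinal.{0}) ≤ β + 5 := by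
    calc (1 : Ordinal.{0}) ≤ 5 := by norm_num
      _ ≤ β + 5 := le_add_self
  have hvβ : ∀ {z}, z ≤ β → z ≤ β + 5 := fun hz => hz.trans le_self_add
  have hsucc : ∃ p, β + 1 = p + 1 := ⟨β, rfl⟩
  have hpos : 0 < β + 1 := lt_of_le_of_lt zero_le (lt_add_one β)
  obtain ⟨m, hok, hlim, hc, ⟨δ1, hδ1, R1⟩, R2⟩ :=
    front (n := n) (eA := eA) (h0 := h0) hg (μ := β) (fun t _ => hg.hd t)
  have hIS : ∀ q x T, (∀ m, q ≠ Aux.scan m) →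
      (∀ x j, (x = 0 ∧ j = Trk.S) ∨ T x j = (enc C β).tp x j ∨ T x j = (enc C' (β + 1)).tp x j) →
      IS n eA h0 C β ⟨(C.state, q), x, T⟩ := by
    intro q x T hq hT
    refine ⟨rfl, ?_, hT⟩
    rintro ⟨h1, -⟩
    cases q
    case scan m' => exact hq m' rfl
    all_goals exact absurd h1 (by simp [mac, H])
  have hbitT : ∀ x j, (x = 0 ∧ j = Trk.S) ∨ tape C β true false x j = (enc C β).tp x j ∨
      tape C β true false x j = (enc C' (β + 1)).tp x j := by
    intro x j
    cases j with
    | F => exact Or.inr (Or.inl rfl)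
    | Z => right; right; simp [enc, tape, hpos]
    | S =>
      by_cases hx : x = 0
      · exact Or.inl ⟨hx, rfl⟩
      · right; left; simp [enc, tape, hx]
    | sym u => exact Or.inr (Or.inl rfl)
    | A u => exact Or.inr (Or.inl rfl)
  have hmono : ∀ d, I2 n eA h0 C β d → IS n eA h0 C β d := by
    rintro d ⟨h1, h2, h3 | h3⟩
    · exact ⟨h1, h2, fun x j => Or.inr (Or.inl (by rw [h3]))⟩
    · exact ⟨h1, h2, by rw [h3]; exact hbitT⟩
  -- the frontier step
  have R3 : (mac M n eA h0).Reach (IS n eA h0 C β) ⟨(C.state, .scan m), β, tape C β true false⟩ 1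
      ⟨(C.state, .retA (s', w, mv) 0), leftOf β, tape (mix C C' 0) (β + 1) true false⟩ := by
    apply Mac.Reach.step
    · refine ⟨rfl, ?_, hbitT⟩
      rintro ⟨h1, -⟩
      rw [mac_H] at h1
      exact hn ((H_iff hg hok hc hlim.1).1 h1).2
    · apply step_write (d := false) (b := wF (tape C β true false β))
      · have hF : tape C β true false β .F = false := by simp [tape]
        simp only [tr, hF, rd_eq hg hok hc, htr]
        simp
      · simp
      · intro j
        cases j <;> simp [wF, tape, mix]
      · intro y hy j
        cases j with
        | F =>
          have : y < β + 1 ↔ y < β := by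
            rw [lt_add_one_iff]
            exact ⟨fun h => lt_of_le_of_ne h hy, le_of_lt⟩
          simp only [tape, this]
        | _ => simp [tape, mix]
  have hbitM : ∀ i x j, (x = 0 ∧ j = Trk.S) ∨
      tape (mix C C' i) (β + 1) true false x j = (enc C β).tp x j ∨
      tape (mix C C' i) (β + 1) true false x j = (enc C' (β + 1)).tp x j := by
    intro i x j
    cases j with
    | F => exact Or.inr (Or.inr rfl)
    | Z => right; right; simp [enc, tape, hpos]
    | S =>
      by_cases hx : x = 0
      · exact Or.inl ⟨hx, rfl⟩
      · right; left; simp [enc, tape, hx]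
    | sym u =>
      by_cases hu : u.1 < i
      · right; right; simp [enc, tape, mix, hu]
      · right; left; simp [enc, tape, mix, hu]
    | A u =>
      by_cases hu : u.1 < i
      · right; right; simp [enc, tape, mix, hu]
      · right; left; simp [enc, tape, mix, hu]
  have R4 : ∀ i (hi : i ≤ M.tapes), ∃ x ≤ β, ∃ δ ≤ (β + 5) * ((7 * i : ℕ) : Ordinal.{0}),
      (mac M n eA h0).Reach (IS n eA h0 C β)
      ⟨(C.state, .retA (s', w, mv) 0), leftOf β, tape (mix C C' 0) (β + 1) true false⟩ δ
      ⟨(C.state, .retA (s', w, mv) ⟨i, Nat.lt_succ_of_le hi⟩), x,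
        tape (mix C C' i) (β + 1) true false⟩ := by
    intro i
    induction i with
    | zero => intro _; exact ⟨leftOf β, leftOf_le β, 0, by simp, Mac.Reach.refl _⟩
    | succ i ih =>
      intro hi
      obtain ⟨x, hx, δ, hδ, R⟩ := ih (by omega)
      have hi' : i < M.tapes := hi
      obtain ⟨x', hx', δ', hδ', R'⟩ := app_one (n := n) (eA := eA) (h0 := h0)
        (D := mix C C' i) (D' := mix C C' (i + 1)) (γ := β + 1) (β := β) (t := ⟨i, hi'⟩)
        (a := (s', w, mv)) (s := C.state) (I := IS n eA h0 C β)
        (by simp [mix, hC'eq])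
        (by intro x; simp [mix, hC'eq])
        (by
          intro u hu
          have : u.1 ≠ i := fun h => hu (Fin.ext h)
          have h2 : u.1 < i + 1 ↔ u.1 < i := by omega
          simp only [mix, h2])
        (by
          intro u hu x
          have : u.1 ≠ i := fun h => hu (Fin.ext h)
          have h2 : u.1 < i + 1 ↔ u.1 < i := by omega
          simp only [mix, h2])
        (by simpa [mix] using hg.hd _)
        (by
          intro q x T hq hT
          apply hIS q x T hq
          intro y j
          rcases hT y j with h | h <;> rw [h]
          · exact hbitM _ _ _
          · exact hbitM _ _ _) hx
      refine ⟨x', hx', _, ?_, R.trans R'⟩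
      exact add_bound hδ hδ'
  obtain ⟨x, hx, δ4, hδ4, R4'⟩ := R4 M.tapes le_rfl
  obtain ⟨l, hl, R5⟩ := Mac.Reach.ret (m := mac M n eA h0) (I := IS n eA h0 C β)
    (q := (C.state, .retA (s', w, mv) ⟨M.tapes, Nat.lt_succ_self _⟩))
    (T := tape (mix C C' M.tapes) (β + 1) true false)
    (fun y => hIS _ _ _ (by simp) (hbitM _))
    (fun y hy => by
      rw [mac_tr]
      have : tape (mix C C' M.tapes) (β + 1) true false y .Z = false := by simp [tape, hy]
      simp [tr, this]) x
  have R6 : (mac M n eA h0).Reach (IS n eA h0 C β)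
      ⟨(C.state, .retA (s', w, mv) ⟨M.tapes, Nat.lt_succ_self _⟩), 0,
        tape (mix C C' M.tapes) (β + 1) true false⟩ 1 (enc C' (β + 1)) := by
    apply Mac.Reach.step (hIS _ _ _ (by simp) (hbitM _))
    unfold enc
    rw [show C'.state = s' by rw [hC'eq]]
    apply step_write (d := false) (b := wS (tape (mix C C' M.tapes) (β + 1) true false 0))
    · have hZ : tape (mix C C' M.tapes) (β + 1) true false 0 .Z = true := by simp [tape]
      simp [tr, hZ]
    · simp [leftOf_zero]
    · intro j
      cases j with
      | F => rfl
      | Z => simp [wS, tape, hpos]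
      | S => simp [wS, tape]
      | sym u => simp [wS, tape, mix, u.2]
      | A u => simp [wS, tape, mix, u.2]
    · intro y hy j
      cases j with
      | F => rfl
      | Z => simp [tape, hy]
      | S => simp [tape, hy]
      | sym u => simp [tape, mix, u.2]
      | A u => simp [tape, mix, u.2]
  refine ⟨_, ?_, ?_, (R1.mono hmono).trans ((R2.mono hmono).trans (R3.trans (R4'.trans
    (R5.trans R6))))⟩
  · simp only [← add_assoc]
    exact lt_of_le_of_lt zero_le (lt_add_one _)
  · refine (add_bound hδ1 (add_bound (one_bound (hvβ le_rfl)) (add_bound (one_bound hv1)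
      (add_bound hδ4 (add_bound (one_bound (hvβ (hl.trans hx))) (one_bound hv1)))))).trans ?_
    apply mul_le_mul_right
    rw [Nat.cast_le]
    omega

theorem Good.zero : Good M.initConfig 0 :=
  ⟨fun _ => le_rfl, fun _ _ _ => rfl⟩

theorem Good.succ {C : OTMConfig M} {β : Ordinal.{0}} (hg : Good C β) :
    Good (M.stepConfig C) (β + 1) := by
  unfold OTMProgram.stepConfig
  split
  · exact ⟨fun t => (hg.hd t).trans (lt_add_one β).le,
      fun t x hx => hg.tp t x ((lt_add_one β).le.trans hx)⟩
  · refine ⟨fun t => ?_, fun t x hx => ?_⟩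
    · dsimp only
      split_ifs
      · exact add_le_add_left (hg.hd t) 1
      · exact (leftOf_le _).trans ((hg.hd t).trans (lt_add_one β).le)
    · dsimp only
      have h1 : β < x := (lt_add_one β).trans_le hx
      rw [if_neg ((hg.hd t).trans_lt h1).ne', hg.tp t x h1.le]

theorem good_run (β : Ordinal.{0}) : Good (M.run β) β := by
  induction β using Ordinal.limitRecOn with
  | zero => rw [OTMProgram.run_zero]; exact Good.zero
  | add_one β ih => rw [OTMProgram.run_succ]; exact ih.succ
  | limit lam hl ih =>
    constructor
    · intro t
      rw [OTMProgram.run_limit_head _ hl]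
      by_contra hc
      rw [not_le, lt_liminfAt] at hc
      obtain ⟨γ, hγ, h⟩ := hc
      exact absurd (((h γ le_rfl hγ).trans_le ((ih γ hγ).hd t)).trans hγ) (lt_irrefl _)
    · intro t x hx
      rw [OTMProgram.run_limit_tape _ hl]
      exact boolLiminfAt_ev hl.bot_lt (fun i _ hi => (ih i hi).tp t x (hi.le.trans hx))

end Sim

open Ordinal Order

theorem exists_normal (d : Ordinal.{0} → Ordinal.{0}) (hd : ∀ β, 0 < d β) :
    ∃ f : Ordinal.{0} → Ordinal.{0}, IsNormal f ∧ f 0 = 0 ∧ ∀ β, f (β + 1) = f β + d β := by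
  let f : Ordinal.{0} → Ordinal.{0} := fun o =>
    Ordinal.limitRecOn (motive := fun _ => Ordinal.{0}) o 0 (fun β ih => ih + d β)
      (fun lam _ ih => ⨆ i : Set.Iio lam, ih i.1 i.2)
  have hf0 : f 0 = 0 := Ordinal.limitRecOn_zero ..
  have hfs : ∀ o, f (o + 1) = f o + d o := fun o => Ordinal.limitRecOn_add_one ..
  have hfl : ∀ o, IsSuccLimit o → f o = ⨆ i : Set.Iio o, f i.1 :=
    fun o ho => Ordinal.limitRecOn_limit _ _ _ _ ho
  refine ⟨f, IsNormal.of_succ_lt ?_ ?_, hf0, hfs⟩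
  · intro a
    rw [succ_eq_add_one, hfs]
    conv_lhs => rw [← add_zero (f a)]
    exact (add_lt_add_iff_left _).2 (hd a)
  · intro a ha
    rw [hfl a ha]
    constructor
    · rintro _ ⟨b, hb, rfl⟩
      exact Ordinal.le_iSup (fun i : Set.Iio a => f i.1) ⟨b, hb⟩
    · intro c hc
      exact Ordinal.iSup_le (fun i => hc ⟨i.1, i.2, rfl⟩)

theorem normal_bound {f d : Ordinal.{0} → Ordinal.{0}} (hf : IsNormal f) (h0 : f 0 = 0)
    (hs : ∀ β, f (β + 1) = f β + d β) {α : Ordinal.{0}} {m : ℕ}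
    (hd : ∀ β < α, d β ≤ (β + 5) * (m : Ordinal.{0})) :
    ∀ β ≤ α, f β ≤ (β + 5) * (m : Ordinal.{0}) * β := by
  intro β
  induction β using Ordinal.limitRecOn with
  | zero => intro _; simp [h0]
  | add_one β ih =>
    intro h
    have hlt : β < α := (lt_add_one β).trans_le h
    rw [hs]
    calc f β + d β ≤ (β + 5) * (m : Ordinal.{0}) * β + (β + 5) * (m : Ordinal.{0}) :=
          add_le_add (ih hlt.le) (hd β hlt)
      _ = (β + 5) * (m : Ordinal.{0}) * (β + 1) := by rw [mul_add, mul_one]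
      _ ≤ _ := by
        refine mul_le_mul_left (mul_le_mul_left ?_ _) _
        exact add_le_add_left (lt_add_one β).le _
  | limit lam hl ih =>
    intro h
    rw [hf.le_iff_forall_le hl]
    intro b hb
    refine (ih b hb (hb.le.trans h)).trans ?_
    refine mul_le_mul' (mul_le_mul_left (add_le_add_left hb.le _) _) hb.le

namespace Sim
variable {M : OTMProgram} {n : ℕ} {eA : Aux M.states M.tapes ≃ Fin (n + 1)}
  {h0 : eA .start = 0}

theorem enc_limit {lam : Ordinal.{0}} (hl : IsSuccLimit lam) (x : Ordinal.{0}) (j : Trk M.tapes)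
    (hj : ¬ (x = 0 ∧ j = .S)) :
    (enc (M.run lam) lam).tp x j =
      boolLiminfAt lam (fun β => (enc (M.run β) β).tp x j) := by
  classical
  cases j with
  | F =>
    symm
    simp only [enc, tape]
    by_cases hx : x < lam
    · refine boolLiminfAt_ev (hl.add_one_lt hx) ?_
      intro i h1 _
      simp [hx, (lt_add_one x).trans_le h1]
    · refine boolLiminfAt_ev hl.bot_lt ?_
      intro i _ h2
      have : ¬ x < i := fun h => hx (h.trans h2)
      simp [hx, this]
  | Z =>
    symm
    simp only [enc, tape]
    refine boolLiminfAt_ev (hl.add_one_lt hl.bot_lt) ?_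
    intro i h1 _
    have h2 : 0 < i := (lt_add_one (0 : Ordinal.{0})).trans_le h1
    have h3 : 0 < lam := hl.bot_lt
    simp [h2, h3]
  | S =>
    symm
    have hx : x ≠ 0 := fun h => hj ⟨h, rfl⟩
    simp only [enc, tape]
    refine boolLiminfAt_ev hl.bot_lt ?_
    intro i _ _
    simp [hx]
  | sym t => exact OTMProgram.run_limit_tape _ hl t x
  | A t =>
    simp only [enc, tape]
    rw [Bool.eq_iff_iff, boolLiminfAt_eq_true, decide_eq_true_iff,
      OTMProgram.run_limit_head _ hl, lt_liminfAt]
    simp only [decide_eq_true_iff]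

theorem run_enc {r : Ordinal.{0} → MCfg (Q M) (Trk M.tapes)} (hr : (mac M n eA h0).IsRun r)
    {f d : Ordinal.{0} → Ordinal.{0}} (hf : IsNormal f) (hf0 : f 0 = 0)
    (hfs : ∀ β, f (β + 1) = f β + d β) {α : Ordinal.{0}}
    (hst : ∀ β < α, (mac M n eA h0).Reach (IS n eA h0 (M.run β) β) (enc (M.run β) β) (d β)
      (enc (M.run (β + 1)) (β + 1))) :
    ∀ β ≤ α, r (f β) = enc (M.run β) β := by
  classical
  intro β
  induction β using Ordinal.limitRecOn with
  | zero =>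
    intro _
    rw [hf0, hr.zero, OTMProgram.run_zero]
    apply MCfg.ext'
    · rfl
    · rfl
    · intro x j
      have h1 : ¬ ∃ p : Ordinal.{0}, 0 = p + 1 := by
        rintro ⟨p, hp⟩
        exact absurd hp (lt_of_le_of_lt zero_le (lt_add_one p)).ne
      have h2 : ¬ x < 0 := not_lt.2 zero_le
      cases j with
      | F => simp [enc, tape]
      | Z => simp [enc, tape]
      | S => simp only [enc, tape, h1]; simp
      | sym t => rfl
      | A t => simp [enc, tape, OTMProgram.initConfig]
  | add_one β ih =>
    intro h
    have hlt : β < α := (lt_add_one β).trans_le h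
    rw [hfs]
    exact (hst β hlt r hr _ (ih hlt.le)).1
  | limit lam hl ih =>
    intro h
    have hfl : IsSuccLimit (f lam) := hf.map_isSuccLimit hl
    have ih' : ∀ β < lam, r (f β) = enc (M.run β) β := fun β hβ => ih β hβ (hβ.le.trans h)
    have hin : ∀ β < lam, ∀ i, f β ≤ i → i < f (β + 1) → IS n eA h0 (M.run β) β (r i) := by
      intro β hβ i h1 h2
      obtain ⟨i', rfl⟩ := exists_add_of_le h1
      rw [hfs] at h2
      exact (hst β (hβ.trans_le h) r hr _ (ih' β hβ)).2 i' (lt_of_add_lt_add_left h2)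
    apply MCfg.ext'
    · apply (mac M n eA h0).eQ.injective
      apply Fin.ext
      rw [hr.lim_st _ hfl, natLiminfAt_timechange (K := n + 1) (B := M.states + 1)
        (b := fun β => ((M.run β).state : ℕ)) hf hf0 (Nat.succ_pos _) hl (fun β _ => (M.run β).state.2),
        ← OTMProgram.run_limit_state _ hl]
      · change _ = (((mac M n eA h0).eQ ((M.run lam).state, .start) : Fin _) : ℕ)
        rw [mac_code, h0]
        simp
      · intro β hβ
        rw [ih' β hβ]
        change (((mac M n eA h0).eQ ((M.run β).state, .start) : Fin _) : ℕ) = _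
        rw [mac_code, h0]
        simp
      · intro β hβ i h1 h2
        left
        obtain ⟨g1, -, -⟩ := hin β hβ i h1 h2
        rw [show (r i).st = ((M.run β).state, (r i).st.2) from Prod.ext g1 rfl, mac_code]
        exact Nat.le_add_left _ _
    · rw [hr.lim_hd _ hfl, liminfAt_timechange (g := id) (b := fun _ => 0) hf hf0 IsNormal.id hl]
      · exact liminfAt_ev hl.bot_lt (fun _ _ _ => rfl)
      · intro β hβ
        rw [ih' β hβ]; rfl
      · intro β _ i _ _
        left; exact zero_le
    · intro x j
      rw [hr.lim_tp _ hfl]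
      by_cases hj : x = 0 ∧ j = .S
      · obtain ⟨rfl, rfl⟩ := hj
        have h1 : ¬ ∃ p, lam = p + 1 := by
          rintro ⟨p, rfl⟩
          have := hl.add_one_lt (lt_add_one p)
          exact lt_irrefl _ this
        have h2 : (enc (M.run lam) lam).tp 0 .S = false := by simp [enc, tape, h1]
        rw [h2, ← Bool.not_eq_true, boolLiminfAt_eq_true]
        rintro ⟨γ, hγ, hh⟩
        obtain ⟨β, hβ, g1, g2⟩ := exists_interval hf hf0 hγ
        have hβ1 := hl.add_one_lt hβ
        have hβ2 := hl.add_one_lt hβ1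
        have g3 : f (β + 1) + 1 < f lam :=
          (Order.add_one_le_of_lt (hf.strictMono (lt_add_one (β + 1)))).trans_lt
            (hf.strictMono hβ2)
        have g4 := hh (f (β + 1) + 1) (g2.le.trans (lt_add_one _).le) g3
        rw [hr.succ, ih' _ hβ1, start_step] at g4
        simp [tape] at g4
      · rw [enc_limit hl x j hj]
        apply boolLiminfAt_timechange hf hf0 hl
        · intro β hβ
          rw [ih' β hβ]
        · intro β hβ i h1 h2
          obtain ⟨-, -, g3⟩ := hin β hβ i h1 h2
          rcases g3 x j with g | g | g
          · exact absurd g hj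
          · exact Or.inl g
          · right
            rw [g, OTMProgram.run_succ]

theorem main {α : Ordinal.{0}} (hl : IsSuccLimit α) (hadd : ∀ a < α, ∀ b < α, a + b < α)
    (hmul : ∀ a < α, ∀ b < α, a * b < α) (hω : ∀ k : ℕ, (k : Ordinal.{0}) < α)
    (hM : M.haltsAt (α + 1)) :
    ∃ P : OTMProgram, P.tapes = 1 ∧ P.haltsAt (α * 2 + 1) := by
  classical
  haveI := Aux.finite M.states M.tapes
  haveI := Trk.finite M.tapes
  obtain ⟨n, eA, h0⟩ := exists_equiv_zero (Aux M.states M.tapes) .start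
  obtain ⟨r, hr⟩ := (mac M n eA h0).exists_run
  have hnh : ∀ β ≤ α, M.trans (M.run β).state (M.readSymbols (M.run β)) ≠ none :=
    fun β hβ => hM.2 β (lt_of_le_of_lt hβ (lt_add_one α))
  have hd : ∀ β, ∃ d, 0 < d ∧ (β < α → d ≤ (β + 5) * ((9 * M.tapes + 5 : ℕ) : Ordinal.{0}) ∧
      (mac M n eA h0).Reach (IS n eA h0 (M.run β) β) (enc (M.run β) β) d
        (enc (M.run (β + 1)) (β + 1))) := by
    intro β
    by_cases hβ : β < α
    · obtain ⟨a, ha⟩ := Option.ne_none_iff_exists'.1 (hnh β hβ.le)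
      have h1 := hnh (β + 1) (Order.add_one_le_of_lt hβ)
      rw [OTMProgram.run_succ] at h1
      obtain ⟨d, g1, g2, g3⟩ := stage (n := n) (eA := eA) (h0 := h0) (good_run β) ha h1
      refine ⟨d, g1, fun _ => ⟨g2, ?_⟩⟩
      rwa [OTMProgram.run_succ]
    · exact ⟨1, zero_lt_one, fun h => absurd h hβ⟩
  choose d hd0 hd1 using hd
  obtain ⟨f, hf, hf0, hfs⟩ := exists_normal d hd0
  have hrun := run_enc hr hf hf0 hfs (fun β hβ => (hd1 β hβ).2)
  have hfα : f α = α := by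
    apply le_antisymm
    · rw [hf.le_iff_forall_le hl]
      intro b hb
      refine (normal_bound hf hf0 hfs (fun β hβ => (hd1 β hβ).1) b hb.le).trans ?_
      exact (hmul _ (hmul _ (hadd _ hb _ (hω 5)) _ (hω _)) _ hb).le
    · exact hf.strictMono.le_apply
  have hrα : r α = enc (M.run α) α := by
    have := hrun α le_rfl
    rwa [hfα] at this
  -- bound for the heads
  set μ : Ordinal.{0} := Finset.univ.sup (fun t => if (M.run α).head t < α then (M.run α).head t else 0)
    with hμdef
  have hμ : μ < α := by
    rw [hμdef, Finset.sup_lt_iff hl.bot_lt]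
    intro t _
    split_ifs with h
    · exact h
    · exact hl.bot_lt
  have hμ' : ∀ t, (M.run α).head t < α → (M.run α).head t ≤ μ := by
    intro t ht
    have := Finset.le_sup (f := fun t => if (M.run α).head t < α then (M.run α).head t else 0)
      (Finset.mem_univ t)
    simpa [ht] using this
  obtain ⟨m, hok, hlim, hc, ⟨δ, hδ, R1⟩, R2⟩ :=
    front (n := n) (eA := eA) (h0 := h0) (good_run α) hμ'
  have hδα : δ < α := hδ.trans_lt (hmul _ (hadd _ hμ _ (hω 5)) _ (hω _))
  have habs : δ + α = α := by
    apply le_antisymm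
    · rw [add_le_iff_of_isSuccLimit hl]
      intro b hb
      exact (hadd _ hδα _ hb).le
    · exact le_add_self
  have R := (R1.trans R2) r hr α hrα
  rw [habs] at R
  have h2 : α * 2 = α + α := by
    rw [← one_add_one_eq_two, mul_add, mul_one]
  refine Mac.realize (mac M n eA h0) hr (θ := α * 2) ?_ ?_ ?_
  · rw [h2, R.1]
    refine ⟨?_, ?_⟩
    · rw [mac_H]
      have hns : ¬ ∃ p, α = p + 1 := by
        rintro ⟨p, rfl⟩
        exact lt_irrefl _ (hl.add_one_lt (lt_add_one p))
      refine (H_iff (good_run α) hok hc hlim.1).2 ⟨hlim.2 hns, ?_⟩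
      have := hM.1
      unfold OTMProgram.haltedAt at this
      rwa [OTMProgram.run_succ] at this
    · change tape (M.run α) α true false α .F = false
      simp [tape]
  · intro τ hτ
    rcases lt_or_ge τ α with h | h
    · rw [← hfα] at h
      obtain ⟨β, hβ, g1, g2⟩ := exists_interval hf hf0 h
      obtain ⟨i, rfl⟩ := exists_add_of_le g1
      rw [hfs] at g2
      exact (((hd1 β hβ).2 r hr _ (hrun β hβ.le)).2 i (lt_of_add_lt_add_left g2)).2.1
    · obtain ⟨i, rfl⟩ := exists_add_of_le h
      rw [h2] at hτ
      exact (R.2 i (lt_of_add_lt_add_left hτ)).2.1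
  · intro k hk
    rw [← mul_assoc]
    congr 1
    apply le_antisymm
    · rw [mul_le_iff_of_isSuccLimit hl]
      intro b hb
      exact (hmul _ (hω k) _ hb).le
    · exact le_mul_of_one_le_left' (by exact_mod_cast hk)

end Sim

/-- finite counters -/
theorem exists_counter (N : ℕ) : ∃ P : OTMProgram, P.tapes = 1 ∧ P.haltsAt (N : Ordinal.{0}) := by
  let P : OTMProgram :=
    { tapes := 1
      states := N
      trans := fun s _ => if h : s.1 < N then
        some (⟨s.1 + 1, Nat.succ_lt_succ h⟩, fun _ => false, fun _ => false) else none }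
  have key : ∀ i : ℕ, i ≤ N → ((P.run (i : Ordinal.{0})).state : ℕ) = i := by
    intro i
    induction i with
    | zero => intro _; rw [Nat.cast_zero, OTMProgram.run_zero]; rfl
    | succ i ih =>
      intro hi
      have h1 := ih (by omega)
      rw [Nat.cast_succ, OTMProgram.run_succ]
      have h2 : P.trans (P.run (i : Ordinal.{0})).state (P.readSymbols (P.run (i : Ordinal.{0}))) =
          some (⟨(P.run (i : Ordinal.{0})).state.1 + 1, by rw [h1]; exact Nat.lt_succ_of_le hi⟩,
            fun _ => false, fun _ => false) :=
        dif_pos (by rw [h1]; omega)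
      unfold OTMProgram.stepConfig
      rw [h2]
      simp [h1]
  refine ⟨P, rfl, ?_, ?_⟩
  · unfold OTMProgram.haltedAt
    exact dif_neg (by rw [key N le_rfl]; omega)
  · intro σ hσ
    obtain ⟨i, rfl⟩ := lt_omega0.1 (hσ.trans (natCast_lt_omega0 N))
    have hi : i < N := by exact_mod_cast hσ
    unfold OTMProgram.haltedAt
    have h2 : P.trans (P.run (i : Ordinal.{0})).state (P.readSymbols (P.run (i : Ordinal.{0}))) =
        some _ := dif_pos (by rw [key i hi.le]; exact hi)
    rw [h2]
    simp

theorem single_tape_clockable' (α : Ordinal.{0}) (hexp : ExpClosed α) (h : OTMClockable α) :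
    ∃ P : OTMProgram, P.tapes = 1 ∧ P.haltsAt (α * 2 + 1) := by
  rcases lt_or_ge α ω with hα | hα
  · obtain ⟨k, rfl⟩ := lt_omega0.1 hα
    have := exists_counter (k * 2 + 1)
    push_cast at this
    exact this
  · have hω : ∀ k : ℕ, (k : Ordinal.{0}) < α := fun k => (natCast_lt_omega0 k).trans_le hα
    have hmul : ∀ a < α, ∀ b < α, a * b < α := by
      intro a ha b hb
      have h1 := hexp (max a b) (max_lt ha hb) 2 (by exact_mod_cast hω 2)
      have h2 : (max a b) ^ (2 : Ordinal.{0}) = max a b * max a b := by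
        rw [← one_add_one_eq_two, opow_add, opow_one]
      rw [h2] at h1
      exact (mul_le_mul' (le_max_left _ _) (le_max_right _ _)).trans_lt h1
    have hadd : ∀ a < α, ∀ b < α, a + b < α := by
      intro a ha b hb
      have h1 := hmul (max a b) (max_lt ha hb) 2 (by exact_mod_cast hω 2)
      rw [← one_add_one_eq_two, mul_add, mul_one] at h1
      exact (add_le_add (le_max_left _ _) (le_max_right _ _)).trans_lt h1
    have hl : IsSuccLimit α := by
      rcases ord_cases α with h1 | ⟨p, h1⟩ | h1
      · rw [h1] at hω
        exact absurd (hω 0) (by simp)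
      · have := hadd p (by rw [h1]; exact lt_add_one p) 1 (by exact_mod_cast hω 1)
        rw [← h1] at this
        exact absurd this (lt_irrefl _)
      · exact h1
    obtain ⟨M, hM⟩ := h
    exact Sim.main hl hadd hmul hω hM

/-- If `α` is exponentially closed and OTM-clockable, then `α · 2` is clockable by an
OTM using only one tape. -/
theorem single_tape_clockable (α : Ordinal.{0}) (hexp : ExpClosed α)
    (h : OTMClockable α) :
    ∃ P : OTMProgram, P.tapes = 1 ∧ P.haltsAt (α * 2 + 1) := by
  exact single_tape_clockable' α hexp h

end
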